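/- arXiv:2504.06711 — 6 statements merged into one kernel-verified Lean document; each statement's English description precedes it below -/
import Mathlib

section
/- Let α ≥ 0, let 2 ≤ k ≤ n, and let λ = (λ_1,…,λ_n) ∈ Γ̃_k with λ_1 ≥ λ_2 ≥ ⋯ ≥ λ_n. Then for every integer l with 1 ≤ l ≤ k−1, one has S_l(λ) > (1/2)·(λ_1⋯λ_{l−1} + α·λ_1⋯λ_l), where the empty product λ_1⋯λ_0 is interpreted as 1. -/
open Finset

/-- The `j`-th elementary symmetric polynomial of `lam` restricted to the index set `A`,
with `σ_0 = 1` and `σ_j = 0` for `j < 0` or `j > |A|`. -/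
noncomputable def esigma {n : ℕ} (A : Finset (Fin n)) (j : ℤ) (lam : Fin n → ℝ) : ℝ :=
  if 0 ≤ j then ∑ s ∈ A.powersetCard j.toNat, ∏ i ∈ s, lam i else 0

/-- The sum Hessian operator `S_j(λ) = σ_{j-1}(λ) + α σ_j(λ)` on the index set `A`. -/
noncomputable def Ssum {n : ℕ} (α : ℝ) (A : Finset (Fin n)) (j : ℤ) (lam : Fin n → ℝ) : ℝ :=
  esigma A (j - 1) lam + α * esigma A j lam

/-- The Gårding cone `Γ_k`. -/
def Gamma (n k : ℕ) : Set (Fin n → ℝ) :=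
  {lam | ∀ j : ℕ, 1 ≤ j → j ≤ k → 0 < esigma Finset.univ (j : ℤ) lam}

/-- The admissible cone `Γ̃_k = Γ_{k-1} ∩ {S_k > 0}`. -/
def GammaTilde (n k : ℕ) (α : ℝ) : Set (Fin n → ℝ) :=
  Gamma n (k - 1) ∩ {lam | 0 < Ssum α Finset.univ (k : ℤ) lam}

open Polynomial in
/-- The derivative of a real-rooted polynomial is real-rooted. -/
theorem splits_derivative_of_splits {p : ℝ[X]} (hp : p.Splits) : p.derivative.Splits := by
  rw [splits_iff_card_roots] at hp ⊢
  have h1 := card_roots_le_derivative p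
  have h2 := card_roots' (derivative p)
  have h3 := natDegree_derivative p
  omega

open Polynomial in
theorem coeff_one_add_C_mul_X_mul (x : ℝ) (q : ℝ[X]) (j : ℕ) :
    ((1 + C x * X) * q).coeff (j + 1) = q.coeff (j + 1) + x * q.coeff j := by
  rw [add_mul, one_mul, mul_assoc, coeff_add, coeff_C_mul, coeff_X_mul]

open Polynomial in
theorem coeff_X_add_C_mul (a : ℝ) (q : ℝ[X]) (j : ℕ) :
    ((X + C a) * q).coeff (j + 1) = q.coeff j + a * q.coeff (j + 1) := by
  rw [add_mul, coeff_add, coeff_X_mul, coeff_C_mul]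

open Polynomial in
theorem two_mul_coeff_zero_mul_coeff_two_le {p : ℝ[X]} (hp : p.Splits) :
    2 * (p.coeff 0 * p.coeff 2) ≤ p.coeff 1 ^ 2 := by
  obtain ⟨m, hm⟩ := splits_iff_exists_multiset'.mp hp
  rw [hm]
  generalize p.leadingCoeff = c
  clear hm hp p
  induction m using Multiset.induction_on with
  | empty => simp [coeff_C]
  | cons a m ih =>
    rw [Multiset.map_cons, Multiset.prod_cons, mul_left_comm (C c)]
    generalize C c * (m.map (X + C ·)).prod = q at ih ⊢
    have h0 : ((X + C a) * q).coeff 0 = a * q.coeff 0 := by simp [add_mul]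
    rw [h0, coeff_X_add_C_mul _ _ 0, coeff_X_add_C_mul _ _ 1]
    nlinarith [mul_le_mul_of_nonneg_left ih (sq_nonneg a), sq_nonneg (q.coeff 0)]

open Polynomial in
/-- A form of Newton's inequality for the coefficients of a real-rooted polynomial. -/
theorem newton_coeff_le {p : ℝ[X]} (hp : p.Splits) (j : ℕ) :
    ((j : ℝ) + 2) * (p.coeff j * p.coeff (j + 2)) ≤ ((j : ℝ) + 1) * p.coeff (j + 1) ^ 2 := by
  induction j generalizing p with
  | zero => simpa using two_mul_coeff_zero_mul_coeff_two_le hp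
  | succ j ih =>
    have h := ih (splits_derivative_of_splits hp)
    simp only [coeff_derivative] at h
    push_cast at h ⊢
    have hpos : (0 : ℝ) < ((j : ℝ) + 1) * ((j : ℝ) + 2) := by positivity
    refine le_of_mul_le_mul_left ?_ hpos
    linarith

open Polynomial in
/-- If the positive-degree coefficients of `(1 + x X) q` are positive up to degree `k + 1`, then
those of `q` are positive up to degree `k`. -/
theorem coeff_pos_of_one_add_C_mul_X_mul {q : ℝ[X]} (hq : q.Splits) (h0 : 0 ≤ q.coeff 0) (x : ℝ)
    {k : ℕ} (h : ∀ j, 1 ≤ j → j ≤ k + 1 → 0 < ((1 + C x * X) * q).coeff j)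
    {j : ℕ} (hj1 : 1 ≤ j) (hjk : j ≤ k) : 0 < q.coeff j := by
  obtain ⟨i, rfl⟩ := Nat.exists_eq_add_of_le' hj1
  induction i with
  | zero => ?_
  | succ i ih => ?_
  all_goals
    have hb1 := h _ hj1 (by omega)
    have hb2 := h _ (Nat.le_succ_of_le hj1) (Nat.succ_le_succ hjk)
    rw [coeff_one_add_C_mul_X_mul] at hb1 hb2
    by_contra! hneg
  · have hN := newton_coeff_le hq 0
    norm_num at *
    have hx : 0 < x * q.coeff 0 := by linarith
    have hc : 0 < q.coeff 0 := lt_of_le_of_ne h0 (by rintro e; simp [← e] at hx)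
    nlinarith [mul_pos hc hb2, mul_nonneg hb1.le (neg_nonneg.2 hneg), sq_nonneg (q.coeff 1)]
  · have hc := ih (by omega) (by omega)
    have hN := newton_coeff_le hq (i + 1)
    have key : q.coeff (i + 1 + 1) ^ 2 < q.coeff (i + 1) * q.coeff (i + 1 + 2) := by
      nlinarith [mul_pos hc hb2, mul_nonneg hb1.le (neg_nonneg.2 hneg)]
    push_cast at hN
    have hi : (0 : ℝ) ≤ i := by positivity
    nlinarith [mul_nonneg hi (sub_nonneg.2 key.le), sq_nonneg (q.coeff (i + 1 + 1))]

open Polynomial in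
/-- The generating polynomial `∏_{i ∈ A} (1 + λ_i X)` of the elementary symmetric polynomials. -/
noncomputable def genPoly {n : ℕ} (A : Finset (Fin n)) (lam : Fin n → ℝ) : ℝ[X] :=
  ∏ i ∈ A, (1 + C (lam i) * X)

open Polynomial in
theorem genPoly_insert {n : ℕ} {a : Fin n} {A : Finset (Fin n)} (ha : a ∉ A) (lam : Fin n → ℝ) :
    genPoly (insert a A) lam = (1 + C (lam a) * X) * genPoly A lam :=
  Finset.prod_insert ha

open Polynomial in
theorem splits_genPoly {n : ℕ} (A : Finset (Fin n)) (lam : Fin n → ℝ) : (genPoly A lam).Splits :=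
  Splits.prod fun i _ => Splits.of_natDegree_le_one (by compute_degree)

open Polynomial in
theorem genPoly_coeff_zero {n : ℕ} (A : Finset (Fin n)) (lam : Fin n → ℝ) :
    (genPoly A lam).coeff 0 = 1 := by
  simp [genPoly, coeff_zero_eq_eval_zero, eval_prod]

open Polynomial in
theorem esigma_eq_coeff_genPoly {n : ℕ} (A : Finset (Fin n)) (lam : Fin n → ℝ) (j : ℕ) :
    esigma A j lam = (genPoly A lam).coeff j := by
  simp only [esigma, Nat.cast_nonneg, if_true, Int.toNat_natCast]
  induction A using Finset.induction_on generalizing j with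
  | empty =>
    cases j with
    | zero => simp [genPoly]
    | succ j =>
      rw [Finset.powersetCard_eq_empty.2 (by simp)]
      simp [genPoly, coeff_one]
  | insert a A ha ih =>
    cases j with
    | zero => simp [genPoly_coeff_zero]
    | succ j =>
      rw [genPoly_insert ha, coeff_one_add_C_mul_X_mul, ← ih, ← ih,
        Finset.powersetCard_succ_insert ha, Finset.sum_union, Finset.sum_image, Finset.mul_sum]
      · congr 1
        refine Finset.sum_congr rfl fun s hs => Finset.prod_insert fun h => ha ?_
        exact (Finset.mem_powersetCard.1 hs).1 h
      · intro s hs t ht hst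
        have hs' : a ∉ s := fun h => ha ((Finset.mem_powersetCard.1 hs).1 h)
        have ht' : a ∉ t := fun h => ha ((Finset.mem_powersetCard.1 ht).1 h)
        rw [← Finset.erase_insert hs', ← Finset.erase_insert ht', hst]
      · rw [Finset.disjoint_left]
        intro s hs hs'
        obtain ⟨t, -, rfl⟩ := Finset.mem_image.1 hs'
        exact ha ((Finset.mem_powersetCard.1 hs).1 (Finset.mem_insert_self a t))

open Polynomial in
theorem Ssum_eq_coeff {n : ℕ} (α : ℝ) (A : Finset (Fin n)) (lam : Fin n → ℝ) (j : ℕ) :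
    Ssum α A ((j + 1 : ℕ) : ℤ) lam = ((X + C α) * genPoly A lam).coeff (j + 1) := by
  rw [coeff_X_add_C_mul, ← esigma_eq_coeff_genPoly, ← esigma_eq_coeff_genPoly, Ssum]
  simp

theorem genPoly_coeff_one {n : ℕ} (A : Finset (Fin n)) (lam : Fin n → ℝ) :
    (genPoly A lam).coeff 1 = ∑ i ∈ A, lam i := by
  rw [← esigma_eq_coeff_genPoly]
  simp [esigma, Finset.powersetCard_one]

/-- The indices of `Fin n` that are at least `m`. -/
def tailIndices (n m : ℕ) : Finset (Fin n) := Finset.univ.filter fun i => m ≤ (i : ℕ)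

theorem tailIndices_zero (n : ℕ) : tailIndices n 0 = Finset.univ := by simp [tailIndices]

open Polynomial in
theorem genPoly_tailIndices {n m : ℕ} (hm : m < n) (lam : Fin n → ℝ) :
    genPoly (tailIndices n m) lam =
      (1 + C (lam ⟨m, hm⟩) * X) * genPoly (tailIndices n (m + 1)) lam := by
  rw [← genPoly_insert (by simp [tailIndices])]
  congr 1
  ext i
  simp only [tailIndices, Finset.mem_filter, Finset.mem_univ, true_and, Finset.mem_insert,
    Fin.ext_iff]
  omega

/-- Removing the first `m` entries of a vector in the Gårding cone `Γ_k` leaves a vector whose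
elementary symmetric polynomials are positive up to degree `k - m`. -/
theorem genPoly_tailIndices_coeff_pos {n k : ℕ} (hkn : k ≤ n) {lam : Fin n → ℝ}
    (hlam : lam ∈ Gamma n k) {m j : ℕ} (hj1 : 1 ≤ j) (hj : j + m ≤ k) :
    0 < (genPoly (tailIndices n m) lam).coeff j := by
  induction m generalizing j with
  | zero =>
    rw [tailIndices_zero, ← esigma_eq_coeff_genPoly]
    exact hlam j hj1 hj
  | succ m ih =>
    refine coeff_pos_of_one_add_C_mul_X_mul (splits_genPoly _ _)
      (by simp [genPoly_coeff_zero]) (lam ⟨m, by omega⟩) (fun i hi1 hi => ?_) hj1 le_rfl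
    rw [← genPoly_tailIndices]
    exact ih hi1 (by omega)

open Polynomial in
/-- Removing the first `m` entries of a vector in `Γ̃_k` leaves a vector whose sums `S_j` are
positive up to degree `k - m`. -/
theorem Ssum_tailIndices_pos {n k : ℕ} {α : ℝ} (hα : 0 ≤ α) (hkn : k ≤ n) {lam : Fin n → ℝ}
    (hlam : lam ∈ GammaTilde n k α) {m j : ℕ} (hj1 : 1 ≤ j) (hj : j + m ≤ k) :
    0 < ((X + C α) * genPoly (tailIndices n m) lam).coeff j := by
  induction m generalizing j with
  | zero =>
    obtain ⟨i, rfl⟩ := Nat.exists_eq_add_of_le' hj1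
    rw [tailIndices_zero]
    obtain rfl | hlt := hj.eq_or_lt
    · rw [← Ssum_eq_coeff]
      exact hlam.2
    · rw [coeff_X_add_C_mul]
      have hpos : ∀ t, t ≤ k - 1 → 0 < (genPoly Finset.univ lam).coeff t := fun t ht => by
        rcases t.eq_zero_or_pos with rfl | h
        · simp [genPoly_coeff_zero]
        · rw [← esigma_eq_coeff_genPoly]
          exact hlam.1 t h ht
      exact add_pos_of_pos_of_nonneg (hpos i (by omega))
        (mul_nonneg hα (hpos (i + 1) (by omega)).le)
  | succ m ih =>
    have hX : (X + C α : ℝ[X]).Splits := Splits.of_natDegree_le_one (by compute_degree)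
    refine coeff_pos_of_one_add_C_mul_X_mul (hX.mul (splits_genPoly _ _))
      (by simpa [genPoly_coeff_zero] using hα) (lam ⟨m, by omega⟩) (fun i hi1 hi => ?_) hj1 le_rfl
    rw [mul_left_comm, ← genPoly_tailIndices]
    exact ih hi1 (by omega)

theorem pos_of_mem_Gamma {n k : ℕ} (hkn : k ≤ n) {lam : Fin n → ℝ} (hlam : lam ∈ Gamma n k)
    (hord : Antitone lam) {m : ℕ} (hm : m < k) : 0 < lam ⟨m, by omega⟩ := by
  by_contra! h
  have hpos := genPoly_tailIndices_coeff_pos hkn hlam (m := m) le_rfl (by omega)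
  rw [genPoly_coeff_one] at hpos
  refine hpos.not_ge (Finset.sum_nonpos fun i hi => (hord ?_).trans h)
  exact (Finset.mem_filter.1 hi).2

theorem prod_filter_val_lt_succ {n m : ℕ} (hm : m < n) (lam : Fin n → ℝ) :
    ∏ i ∈ Finset.univ.filter (fun i : Fin n => (i : ℕ) < m + 1), lam i =
      (∏ i ∈ Finset.univ.filter (fun i : Fin n => (i : ℕ) < m), lam i) * lam ⟨m, hm⟩ := by
  rw [mul_comm, ← Finset.prod_insert (by simp)]
  congr 1
  ext i
  simp only [Finset.mem_filter, Finset.mem_univ, true_and, Finset.mem_insert, Fin.ext_iff]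
  omega

open Polynomial in
theorem prod_mul_Ssum_tailIndices_le {n k : ℕ} {α : ℝ} (hα : 0 ≤ α) (hkn : k ≤ n)
    {lam : Fin n → ℝ} (hlam : lam ∈ GammaTilde n k α) (hord : Antitone lam)
    {m j : ℕ} (hj1 : 1 ≤ j) (hj : m + j < k) :
    0 < ∏ i ∈ Finset.univ.filter (fun i : Fin n => (i : ℕ) < m), lam i ∧
    (∏ i ∈ Finset.univ.filter (fun i : Fin n => (i : ℕ) < m), lam i) *
        ((X + C α) * genPoly (tailIndices n m) lam).coeff j ≤
      ((X + C α) * genPoly Finset.univ lam).coeff (m + j) := by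
  induction m generalizing j with
  | zero => simp [tailIndices_zero]
  | succ m ih =>
    obtain ⟨hprod, hle⟩ := ih (j := j + 1) (by omega) (by omega)
    have hx : 0 < lam ⟨m, by omega⟩ := pos_of_mem_Gamma (by omega) hlam.1 hord (by omega)
    rw [prod_filter_val_lt_succ (by omega)]
    refine ⟨mul_pos hprod hx, ?_⟩
    rw [show m + 1 + j = m + (j + 1) by omega]
    refine le_trans ?_ hle
    rw [mul_assoc]
    refine mul_le_mul_of_nonneg_left ?_ hprod.le
    rw [genPoly_tailIndices (m := m) (by omega), mul_left_comm, coeff_one_add_C_mul_X_mul]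
    have := Ssum_tailIndices_pos hα hkn hlam (m := m + 1) (j := j + 1) (by omega) (by omega)
    linarith

open Polynomial in
theorem half_lt_coeff_one_X_add_C_mul {q : ℝ[X]} (hq : q.Splits) (hq0 : q.coeff 0 = 1) {α x : ℝ}
    (hα : 0 ≤ α) (h1 : 0 < ((X + C α) * ((1 + C x * X) * q)).coeff 1)
    (h2 : 0 < ((X + C α) * ((1 + C x * X) * q)).coeff 2) :
    1 / 2 * (1 + α * x) < ((X + C α) * ((1 + C x * X) * q)).coeff 1 := by
  have h0 : ((1 + C x * X) * q).coeff 0 = 1 := by simp [mul_coeff_zero, hq0]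
  have hN := two_mul_coeff_zero_mul_coeff_two_le hq
  rw [coeff_X_add_C_mul _ _ 0, coeff_one_add_C_mul_X_mul _ _ 0, h0, hq0] at h1 ⊢
  rw [coeff_X_add_C_mul _ _ 1, coeff_one_add_C_mul_X_mul _ _ 0,
    coeff_one_add_C_mul_X_mul _ _ 1, hq0] at h2
  rw [hq0] at hN
  norm_num at *
  generalize q.coeff 1 = a at *
  generalize q.coeff 2 = b at *
  by_contra! hle
  have hsq : (1 + α * (a + x)) ^ 2 ≤ (1 / 2 * (1 + α * x)) ^ 2 := pow_le_pow_left₀ h1.le hle 2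
  nlinarith [mul_nonneg hα h2.le, mul_nonneg (sq_nonneg α) (sub_nonneg.2 hN),
    sq_nonneg (1 - α * x), sq_nonneg (α * x)]

/-- Lemma 2.3 (i): for ordered `λ ∈ Γ̃_k` and `1 ≤ l ≤ k-1`,
`S_l(λ) > (1/2)(λ_1 ⋯ λ_{l-1} + α λ_1 ⋯ λ_l)`. -/
theorem Ssum_lower_bound {n k : ℕ} (α : ℝ) (hα : 0 ≤ α) (hk2 : 2 ≤ k) (hkn : k ≤ n)
    (lam : Fin n → ℝ) (hlam : lam ∈ GammaTilde n k α) (hord : Antitone lam)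
    (l : ℕ) (hl1 : 1 ≤ l) (hlk : l ≤ k - 1) :
    Ssum α Finset.univ (l : ℤ) lam
      > (1 / 2) * ((∏ i ∈ Finset.univ.filter (fun i : Fin n => (i : ℕ) < l - 1), lam i)
          + α * ∏ i ∈ Finset.univ.filter (fun i : Fin n => (i : ℕ) < l), lam i) := by
  obtain ⟨m, rfl⟩ := Nat.exists_eq_add_of_le' hl1
  have hm : m < n := by omega
  obtain ⟨hprod, hle⟩ := prod_mul_Ssum_tailIndices_le hα hkn hlam hord (m := m) (j := 1) le_rfl
    (by omega)
  have h1 := Ssum_tailIndices_pos hα hkn hlam (m := m) (j := 1) le_rfl (by omega)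
  have h2 := Ssum_tailIndices_pos hα hkn hlam (m := m) (j := 2) (by omega) (by omega)
  rw [Ssum_eq_coeff, Nat.add_sub_cancel, prod_filter_val_lt_succ hm]
  refine lt_of_lt_of_le ?_ hle
  rw [genPoly_tailIndices hm] at h1 h2 ⊢
  have hhalf := half_lt_coeff_one_X_add_C_mul (splits_genPoly _ _) (genPoly_coeff_zero _ _) hα h1 h2
  linarith [mul_lt_mul_of_pos_left hhalf hprod]
end

section
/- Let α ≥ 0, let 1 ≤ l < k ≤ n, set ϑ = 1/(k−l), and let λ ∈ Γ̃_k. For ξ = (ξ_1,…,ξ_n) ∈ ℝ^n write A_k := Σ_p S_k^{pp}(λ)·ξ_p and A_l := Σ_p S_l^{pp}(λ)·ξ_p. Then: (a) −(1/S_k(λ))·Σ_{p≠q} S_k^{pp,qq}(λ)·ξ_p·ξ_q + (1/S_l(λ))·Σ_{p≠q} S_l^{pp,qq}(λ)·ξ_p·ξ_q ≥ (A_k/S_k(λ) − A_l/S_l(λ))·((ϑ−1)·A_k/S_k(λ) − (ϑ+1)·A_l/S_l(λ)); and (b) for every δ with 0 < δ < 1, −Σ_{p≠q} S_k^{pp,qq}(λ)·ξ_p·ξ_q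 + (1−ϑ+ϑ/δ)·A_k²/S_k(λ) ≥ S_k(λ)·(ϑ+1−δϑ)·(A_l/S_l(λ))² − (S_k(λ)/S_l(λ))·Σ_{p≠q} S_l^{pp,qq}(λ)·ξ_p·ξ_q. -/
open Finset

open Polynomial

section Laguerre

/-- Laguerre's inequality for a real polynomial that is a product of linear factors. -/
lemma laguerre_prod_X_sub_C (s : Multiset ℝ) (x : ℝ) :
    (s.map fun a => X - C a).prod.eval x *
        (derivative (derivative (s.map fun a => X - C a).prod)).eval x
      ≤ (derivative (s.map fun a => X - C a).prod).eval x ^ 2 := by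
  induction s using Multiset.induction_on with
  | empty => simp
  | cons a s ih =>
    simp only [Multiset.map_cons, Multiset.prod_cons, derivative_mul, derivative_add,
      derivative_sub, derivative_X, derivative_C, eval_add, eval_mul, eval_sub, eval_X, eval_C,
      eval_one, eval_zero, sub_zero, derivative_one]
    nlinarith [mul_nonneg (sq_nonneg (x - a)) (sub_nonneg.2 ih),
      sq_nonneg ((s.map fun a => X - C a).prod.eval x)]

lemma Polynomial.Splits.laguerre {p : ℝ[X]} (hp : p.Splits) (x : ℝ) :
    p.eval x * (derivative (derivative p)).eval x ≤ (derivative p).eval x ^ 2 := by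
  have h := mul_le_mul_of_nonneg_left (laguerre_prod_X_sub_C p.roots x)
    (sq_nonneg p.leadingCoeff)
  rw [hp.eq_prod_roots]
  simp only [derivative_C_mul, eval_C_mul]
  nlinarith [h]

/-- By Rolle's theorem, the derivative of a real-rooted polynomial is real-rooted. -/
lemma Polynomial.Splits.derivative_real {p : ℝ[X]} (hp : p.Splits) :
    (derivative p).Splits := by
  rw [splits_iff_card_roots]
  have h1 := card_roots_le_derivative p
  have h2 := card_roots' (derivative p)
  have h3 := natDegree_derivative_le p
  have h4 := hp.natDegree_eq_card_roots
  by_cases h0 : p.natDegree = 0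
  · rw [eq_C_of_natDegree_eq_zero h0]
    simp
  · omega

lemma Polynomial.Splits.iterate_derivative_real {p : ℝ[X]} (hp : p.Splits) (m : ℕ) :
    (derivative^[m] p).Splits := by
  induction m with
  | zero => exact hp
  | succ m ih =>
    rw [Function.iterate_succ_apply']
    exact ih.derivative_real

/-- Newton's inequality, in its weak form, for the coefficients of a real-rooted polynomial. -/
lemma Polynomial.Splits.coeff_mul_coeff_le {p : ℝ[X]} (hp : p.Splits) (m : ℕ) :
    p.coeff m * p.coeff (m + 2) ≤ p.coeff (m + 1) ^ 2 := by
  have h := (hp.iterate_derivative_real m).laguerre 0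
  rw [← Function.iterate_succ_apply' derivative, ← Function.iterate_succ_apply' derivative,
    ← coeff_zero_eq_eval_zero, ← coeff_zero_eq_eval_zero, ← coeff_zero_eq_eval_zero,
    coeff_iterate_derivative, coeff_iterate_derivative, coeff_iterate_derivative] at h
  simp only [zero_add, Nat.descFactorial_self, nsmul_eq_mul, Nat.succ_eq_add_one,
    Nat.factorial_succ, Nat.cast_mul, Nat.cast_add, Nat.cast_one] at h
  have hf : (0 : ℝ) < (m.factorial : ℝ) ^ 2 * (m + 1) := by positivity
  have h' : (p.coeff m * p.coeff (m + 2)) * (m + 2) ≤ p.coeff (m + 1) ^ 2 * (m + 1) := by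
    refine le_of_mul_le_mul_left ?_ hf
    simp only [show m + 1 + 1 = m + 2 from rfl] at h
    nlinarith [h]
  have hm : (0 : ℝ) ≤ m := m.cast_nonneg
  by_contra! hlt
  nlinarith [sq_nonneg (p.coeff (m + 1))]

end Laguerre

section IntEsymm

variable {ι R : Type*} [CommRing R]

/-- The `j`-th elementary symmetric polynomial of `x` over the index set `A`, extended by zero to
negative `j`. -/
def intEsymm (A : Finset ι) (j : ℤ) (x : ι → R) : R :=
  if 0 ≤ j then ∑ s ∈ A.powersetCard j.toNat, ∏ i ∈ s, x i else 0

lemma intEsymm_of_neg (A : Finset ι) {j : ℤ} (hj : j < 0) (x : ι → R) : intEsymm A j x = 0 :=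
  if_neg (not_le.2 hj)

lemma intEsymm_natCast (A : Finset ι) (j : ℕ) (x : ι → R) :
    intEsymm A j x = ∑ s ∈ A.powersetCard j, ∏ i ∈ s, x i := by
  simp [intEsymm]

@[simp]
lemma intEsymm_zero (A : Finset ι) (x : ι → R) : intEsymm A 0 x = 1 := by
  simp [intEsymm]

lemma intEsymm_empty (j : ℤ) (x : ι → R) : intEsymm ∅ j x = if j = 0 then 1 else 0 := by
  rcases lt_trichotomy j 0 with h | rfl | h
  · rw [intEsymm_of_neg _ h, if_neg h.ne]
  · simp
  · lift j to ℕ using h.le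
    have hj : 0 < j := by exact_mod_cast h
    rw [intEsymm_natCast, Finset.powersetCard_eq_empty.2 (by simpa using hj)]
    simp [hj.ne']

lemma map_intEsymm {S : Type*} [CommRing S] (φ : R →+* S) (A : Finset ι) (j : ℤ) (x : ι → R) :
    φ (intEsymm A j x) = intEsymm A j fun i => φ (x i) := by
  unfold intEsymm
  split_ifs <;> simp

lemma intEsymm_map {κ : Type*} (f : κ ↪ ι) (A : Finset κ) (j : ℤ) (x : ι → R) :
    intEsymm (A.map f) j x = intEsymm A j fun i => x (f i) := by
  unfold intEsymm
  split_ifs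
  · simp [Finset.powersetCard_map]
  · rfl

variable [DecidableEq ι]

lemma intEsymm_insert {A : Finset ι} {a : ι} (ha : a ∉ A) (j : ℤ) (x : ι → R) :
    intEsymm (insert a A) j x = intEsymm A j x + x a * intEsymm A (j - 1) x := by
  rcases lt_trichotomy j 0 with h | rfl | h
  · simp [intEsymm_of_neg _ h, intEsymm_of_neg _ (show j - 1 < 0 by omega)]
  · rw [intEsymm_of_neg A (show (0 : ℤ) - 1 < 0 by omega)]
    simp
  · obtain ⟨m, rfl⟩ : ∃ m : ℕ, j = (m + 1 : ℕ) := ⟨(j - 1).toNat, by omega⟩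
    rw [show ((m + 1 : ℕ) : ℤ) - 1 = m by omega]
    simp only [intEsymm_natCast]
    rw [Finset.powersetCard_succ_insert ha, Finset.sum_union, Finset.mul_sum, Finset.sum_image]
    · congr 1
      refine Finset.sum_congr rfl fun s hs => Finset.prod_insert fun h => ?_
      exact ha ((Finset.mem_powersetCard.1 hs).1 h)
    · intro s hs t ht hst
      have h1 : a ∉ s := fun h => ha ((Finset.mem_powersetCard.1 hs).1 h)
      have h2 : a ∉ t := fun h => ha ((Finset.mem_powersetCard.1 ht).1 h)
      rw [← Finset.erase_insert h1, ← Finset.erase_insert h2]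
      exact congrArg (fun u => Finset.erase u a) hst
    · rw [Finset.disjoint_left]
      intro s hs hs'
      obtain ⟨t, -, rfl⟩ := Finset.mem_image.1 hs'
      exact ha ((Finset.mem_powersetCard.1 hs).1 (Finset.mem_insert_self _ _))

lemma intEsymm_eq_erase {A : Finset ι} {a : ι} (ha : a ∈ A) (j : ℤ) (x : ι → R) :
    intEsymm A j x = intEsymm (A.erase a) j x + x a * intEsymm (A.erase a) (j - 1) x := by
  conv_lhs => rw [← Finset.insert_erase ha]
  exact intEsymm_insert (Finset.notMem_erase _ _) _ _

/-- Summing over the erased index, with one index split off. -/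
lemma sum_mul_intEsymm_erase_insert {A : Finset ι} {a : ι} (ha : a ∉ A) (j : ℤ) (x y : ι → R) :
    ∑ i ∈ insert a A, y i * intEsymm ((insert a A).erase i) j x =
      y a * intEsymm A j x + (∑ i ∈ A, y i * intEsymm (A.erase i) j x +
        x a * ∑ i ∈ A, y i * intEsymm (A.erase i) (j - 1) x) := by
  rw [Finset.sum_insert ha, Finset.erase_insert ha, Finset.mul_sum, ← Finset.sum_add_distrib]
  congr 1
  refine Finset.sum_congr rfl fun i hi => ?_
  have hne : a ≠ i := fun h => ha (h ▸ hi)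
  rw [Finset.erase_insert_of_ne hne,
    intEsymm_insert fun h => ha (Finset.mem_of_mem_erase h)]
  ring

/-- Euler's identity for elementary symmetric polynomials. -/
lemma sum_mul_intEsymm_erase (A : Finset ι) (j : ℤ) (x : ι → R) :
    ∑ i ∈ A, x i * intEsymm (A.erase i) (j - 1) x = j * intEsymm A j x := by
  induction A using Finset.induction_on generalizing j with
  | empty =>
    rw [intEsymm_empty]
    split_ifs with h <;> simp [h]
  | insert a A ha ih =>
    rw [sum_mul_intEsymm_erase_insert ha, ih, ih, intEsymm_insert ha]
    push_cast
    ring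

lemma derivative_intEsymm (A : Finset ι) (j : ℤ) (x : ι → R[X]) :
    derivative (intEsymm A j x) =
      ∑ i ∈ A, derivative (x i) * intEsymm (A.erase i) (j - 1) x := by
  induction A using Finset.induction_on generalizing j with
  | empty =>
    rw [intEsymm_empty]
    split_ifs <;> simp
  | insert a A ha ih =>
    rw [sum_mul_intEsymm_erase_insert ha, intEsymm_insert ha, derivative_add, derivative_mul,
      ih, ih]
    ring

end IntEsymm

section GardingCone

variable {ι : Type*}

/-- Newton's inequality, in its weak form, for elementary symmetric polynomials. -/
lemma intEsymm_mul_intEsymm_le (A : Finset ι) (j : ℤ) (x : ι → ℝ) :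
    intEsymm A (j - 1) x * intEsymm A (j + 1) x ≤ intEsymm A j x ^ 2 := by
  rcases le_or_gt j 0 with hj | hj
  · rw [intEsymm_of_neg A (show j - 1 < 0 by omega), zero_mul]
    positivity
  obtain ⟨m, rfl⟩ : ∃ m : ℕ, j = (m + 1 : ℕ) := ⟨(j - 1).toNat, by omega⟩
  rw [show ((m + 1 : ℕ) : ℤ) - 1 = m by omega,
    show ((m + 1 : ℕ) : ℤ) + 1 = (m + 2 : ℕ) by omega]
  simp only [intEsymm_natCast]
  rcases lt_or_ge A.card (m + 2) with h | h
  · rw [Finset.powersetCard_eq_empty.2 h]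
    simpa using sq_nonneg _
  · obtain ⟨r, hr⟩ := Nat.exists_eq_add_of_le h
    have hp : (∏ i ∈ A, (X + C (x i))).Splits := Splits.prod fun i _ => Splits.X_add_C _
    have hN := hp.coeff_mul_coeff_le r
    rw [Finset.prod_X_add_C_coeff A x (by omega), Finset.prod_X_add_C_coeff A x (by omega),
      Finset.prod_X_add_C_coeff A x (by omega), show A.card - r = m + 2 by omega,
      show A.card - (r + 2) = m by omega, show A.card - (r + 1) = m + 1 by omega] at hN
    linarith

/-- Erasing an index maps the Gårding cone of order `k + 1` to the one of order `k`. -/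
lemma intEsymm_erase_pos [DecidableEq ι] {A : Finset ι} {x : ι → ℝ} {i : ι} (hi : i ∈ A) (k : ℕ)
    (h : ∀ j : ℕ, j ≤ k + 1 → 0 < intEsymm A j x) :
    ∀ j : ℕ, j ≤ k → 0 < intEsymm (A.erase i) j x := by
  induction k with
  | zero =>
    intro j hj
    obtain rfl : j = 0 := by omega
    simp
  | succ k ih =>
    have ih' := ih fun j hj => h j (by omega)
    intro j hj
    rcases Nat.lt_or_ge j (k + 1) with hlt | hge
    · exact ih' j (by omega)
    obtain rfl : j = k + 1 := by omega
    have hb := ih' k le_rfl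
    have h1 := h (k + 1) (by omega)
    have h2 := h (k + 2) (by omega)
    have hN := intEsymm_mul_intEsymm_le (A.erase i) ((k + 1 : ℕ) : ℤ) x
    rw [intEsymm_eq_erase hi] at h1 h2
    rw [show ((k + 1 : ℕ) : ℤ) - 1 = k by omega] at h1 hN
    rw [show ((k + 2 : ℕ) : ℤ) - 1 = (k + 1 : ℕ) by omega] at h2
    rw [show ((k + 1 : ℕ) : ℤ) + 1 = (k + 2 : ℕ) by omega] at hN
    by_contra! hle
    nlinarith [mul_nonneg (neg_nonneg.2 hle) h1.le, mul_pos hb h2]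

end GardingCone

section Concavity

/-- The second derivative at `0` of the quotient `u / v`, multiplied by `v ^ 3`. -/
noncomputable def quotSecond (v u : ℝ[X]) : ℝ :=
  (derivative (derivative u)).eval 0 * v.eval 0 ^ 2
    - 2 * (derivative u).eval 0 * (derivative v).eval 0 * v.eval 0
    - u.eval 0 * v.eval 0 * (derivative (derivative v)).eval 0
    + 2 * u.eval 0 * (derivative v).eval 0 ^ 2

lemma quotSecond_sum {ι : Type*} (v : ℝ[X]) (A : Finset ι) (u : ι → ℝ[X]) :
    quotSecond v (∑ i ∈ A, u i) = ∑ i ∈ A, quotSecond v (u i) := by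
  simp only [quotSecond, derivative_sum, eval_finsetSum, Finset.sum_mul, Finset.mul_sum,
    Finset.sum_add_distrib, Finset.sum_sub_distrib]

lemma quotSecond_C_mul (v u : ℝ[X]) (c : ℝ) :
    quotSecond v (C c * u) = c * quotSecond v u := by
  simp only [quotSecond, derivative_C_mul, eval_C_mul]
  ring

lemma quotSecond_C_mul_left (v u : ℝ[X]) (c : ℝ) :
    quotSecond (C c * v) u = c ^ 2 * quotSecond v u := by
  simp only [quotSecond, derivative_C_mul, eval_C_mul]
  ring

/-- Concavity of the harmonic combination `x q / (x + q)`, with `q = a / b` concave and `x`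
affine. -/
lemma quotSecond_mul_nonpos {a b x : ℝ[X]} (hx : derivative (derivative x) = 0)
    (hb : 0 < b.eval 0) (hv : 0 < (a + x * b).eval 0) (hab : quotSecond b a ≤ 0) :
    quotSecond (a + x * b) (x * a) ≤ 0 := by
  have key : b.eval 0 * quotSecond (a + x * b) (x * a) =
      (a + x * b).eval 0 * x.eval 0 ^ 2 * quotSecond b a
      - 2 * ((derivative x).eval 0 * a.eval 0 * b.eval 0 - x.eval 0 *
        ((derivative a).eval 0 * b.eval 0 - a.eval 0 * (derivative b).eval 0)) ^ 2 := by
    simp only [quotSecond, derivative_add, derivative_mul, eval_add, eval_mul, hx, eval_zero]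
    ring
  have h1 := mul_nonneg (mul_nonneg hv.le (sq_nonneg (x.eval 0))) (neg_nonneg.2 hab)
  by_contra! hpos
  nlinarith [mul_pos hb hpos, sq_nonneg ((derivative x).eval 0 * a.eval 0 * b.eval 0 - x.eval 0 *
        ((derivative a).eval 0 * b.eval 0 - a.eval 0 * (derivative b).eval 0))]

/-- The quotient of consecutive elementary symmetric polynomials is concave on the Gårding cone,
along affine lines. -/
lemma quotSecond_intEsymm_nonpos {ι : Type*} [DecidableEq ι] (x : ι → ℝ[X])
    (hx : ∀ i, derivative (derivative (x i)) = 0) (k : ℕ) (A : Finset ι)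
    (h : ∀ j : ℕ, j ≤ k + 1 → 0 < (intEsymm A j x).eval 0) :
    quotSecond (intEsymm A k x) (intEsymm A (k + 1) x) ≤ 0 := by
  have hev (B : Finset ι) (j : ℤ) :
      (intEsymm B j x).eval 0 = intEsymm B j fun i => (x i).eval 0 :=
    map_intEsymm (evalRingHom 0) B j x
  induction k generalizing A with
  | zero =>
    have hE := sum_mul_intEsymm_erase A 1 x
    simp only [sub_self, intEsymm_zero, mul_one, Int.cast_one, one_mul] at hE
    simp [quotSecond, ← hE, hx]
  | succ k ih =>
    suffices hs : ((k : ℝ) + 2) *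
        quotSecond (intEsymm A (k + 1 : ℕ) x) (intEsymm A ((k + 1 : ℕ) + 1) x) ≤ 0 from
      nonpos_of_mul_nonpos_right hs (by positivity)
    have hE := sum_mul_intEsymm_erase A ((k + 1 : ℕ) + 1) x
    have hc : ((((k + 1 : ℕ) + 1 : ℤ) : ℤ) : ℝ[X]) = C ((k : ℝ) + 2) := by
      push_cast
      simp only [map_add, map_natCast, map_ofNat]
      ring
    rw [hc, add_sub_cancel_right] at hE
    rw [← quotSecond_C_mul, ← hE, quotSecond_sum]
    refine Finset.sum_nonpos fun i hi => ?_
    have hA : ∀ j : ℕ, j ≤ k + 1 → 0 < (intEsymm (A.erase i) j x).eval 0 := by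
      simp only [hev] at h ⊢
      exact intEsymm_erase_pos hi (k + 1) h
    have hv := h (k + 1) (by omega)
    rw [intEsymm_eq_erase hi, show ((k + 1 : ℕ) : ℤ) - 1 = k by omega] at hv ⊢
    refine quotSecond_mul_nonpos (hx i) (hA k (by omega)) hv ?_
    simpa using ih (A.erase i) hA

/-- The polynomial `S_j = σ_{j-1} + α σ_j` in the entries `x`. -/
noncomputable def sumHessian {ι : Type*} (α : ℝ) (A : Finset ι) (j : ℤ) (x : ι → ℝ[X]) : ℝ[X] :=
  intEsymm A (j - 1) x + C α * intEsymm A j x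

/-- For `α ≠ 0`, the sum Hessian polynomial is an elementary symmetric polynomial with one more
entry. -/
lemma C_mul_intEsymm_insertNone {ι : Type*} {α : ℝ} (hα : α ≠ 0) (A : Finset ι)
    (j : ℤ) (x : ι → ℝ[X]) :
    C α * intEsymm A.insertNone j (fun i => i.elim (C α⁻¹) x) = sumHessian α A j x := by
  classical
  have hins : A.insertNone = insert none (A.map Function.Embedding.some) := by
    ext i
    cases i <;> simp
  have hC : C α * C α⁻¹ = 1 := by rw [← C_mul, mul_inv_cancel₀ hα, C_1]
  rw [hins, intEsymm_insert (by simp), intEsymm_map, intEsymm_map, sumHessian]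
  simp only [Function.Embedding.some_apply, Option.elim_some, Option.elim_none]
  linear_combination intEsymm A (j - 1) x * hC

/-- The quotient of consecutive sum Hessian operators is concave along affine lines. -/
lemma quotSecond_sumHessian_nonpos {ι : Type*} {α : ℝ} (hα : 0 ≤ α) (A : Finset ι)
    (x : ι → ℝ[X]) (hx : ∀ i, derivative (derivative (x i)) = 0) {k : ℕ} (hk : 1 ≤ k)
    (h : ∀ j : ℕ, j ≤ k → 0 < (intEsymm A j x).eval 0)
    (hS : 0 < (sumHessian α A (k + 1) x).eval 0) :
    quotSecond (sumHessian α A k x) (sumHessian α A (k + 1) x) ≤ 0 := by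
  classical
  rcases hα.eq_or_lt with rfl | hpos
  · obtain ⟨m, rfl⟩ := Nat.exists_eq_add_of_le' hk
    simpa [sumHessian] using quotSecond_intEsymm_nonpos x hx m A h
  · rw [← C_mul_intEsymm_insertNone hpos.ne', ← C_mul_intEsymm_insertNone hpos.ne',
      quotSecond_C_mul, quotSecond_C_mul_left]
    refine mul_nonpos_of_nonneg_of_nonpos hα (mul_nonpos_of_nonneg_of_nonpos (sq_nonneg α) ?_)
    refine quotSecond_intEsymm_nonpos _ ?_ k _ fun j hj => ?_
    · rintro (_ | i) <;> simp [hx]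
    · refine pos_of_mul_pos_right (a := α) ?_ hα
      rw [← eval_C_mul, C_mul_intEsymm_insertNone hpos.ne']
      rcases hj.eq_or_lt with rfl | hj'
      · exact_mod_cast hS
      · rcases j with _ | j
        · simpa [sumHessian, intEsymm_of_neg] using hpos
        · have h1 := h j (by omega)
          have h2 := h (j + 1) (by omega)
          rw [sumHessian, show ((j + 1 : ℕ) : ℤ) - 1 = j by omega, eval_add, eval_C_mul]
          positivity

/-- If `c - a ^ 2` decreases at each step by at least the square of the increment of `a`, then the
total decrease is controlled by the square of the total increment of `a`. -/
lemma sq_sub_le_mul_sub_of_step (a c : ℕ → ℝ) (l m : ℕ)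
    (h : ∀ j, l ≤ j → j < l + m →
      (a (j + 1) - a j) ^ 2 ≤ (c j - a j ^ 2) - (c (j + 1) - a (j + 1) ^ 2)) :
    (a (l + m) - a l) ^ 2 ≤ m * ((c l - a l ^ 2) - (c (l + m) - a (l + m) ^ 2)) := by
  have h1 := Finset.sum_range_sub (fun i => a (l + i)) m
  have h2 := Finset.sum_range_sub' (fun i => c (l + i) - a (l + i) ^ 2) m
  simp only [add_zero] at h1 h2
  rw [← h1, ← h2]
  refine sq_sum_le_card_mul_sum_sq.trans ?_
  rw [Finset.card_range]
  gcongr with i hi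
  exact h (l + i) (by omega) (by simp at hi; omega)

end Concavity

section Jets

variable {n : ℕ}

/-- The affine line through `lam` with direction `ξ`. -/
noncomputable def affineLine (lam ξ : Fin n → ℝ) (i : Fin n) : ℝ[X] := C (lam i) + C (ξ i) * X

lemma derivative_affineLine (lam ξ : Fin n → ℝ) (i : Fin n) :
    derivative (affineLine lam ξ i) = C (ξ i) := by
  simp [affineLine]

lemma eval_intEsymm_affineLine (A : Finset (Fin n)) (j : ℤ) (lam ξ : Fin n → ℝ) :
    (intEsymm A j (affineLine lam ξ)).eval 0 = esigma A j lam := by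
  refine (map_intEsymm (evalRingHom (0 : ℝ)) A j _).trans ?_
  simp [affineLine, intEsymm, esigma]

lemma eval_sumHessian_affineLine (α : ℝ) (A : Finset (Fin n)) (j : ℤ) (lam ξ : Fin n → ℝ) :
    (sumHessian α A j (affineLine lam ξ)).eval 0 = Ssum α A j lam := by
  simp [sumHessian, Ssum, eval_intEsymm_affineLine]

lemma derivative_sumHessian_affineLine (α : ℝ) (A : Finset (Fin n)) (j : ℤ)
    (lam ξ : Fin n → ℝ) :
    derivative (sumHessian α A j (affineLine lam ξ)) =
      ∑ p ∈ A, C (ξ p) * sumHessian α (A.erase p) (j - 1) (affineLine lam ξ) := by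
  simp only [sumHessian, derivative_add, derivative_C_mul, derivative_intEsymm,
    derivative_affineLine, Finset.mul_sum, ← Finset.sum_add_distrib]
  exact Finset.sum_congr rfl fun p _ => by ring

lemma eval_derivative_sumHessian (α : ℝ) (j : ℤ) (lam ξ : Fin n → ℝ) :
    (derivative (sumHessian α Finset.univ j (affineLine lam ξ))).eval 0 =
      ∑ p : Fin n, Ssum α (Finset.univ \ {p}) (j - 1) lam * ξ p := by
  rw [derivative_sumHessian_affineLine, eval_finsetSum]
  refine Finset.sum_congr rfl fun p _ => ?_
  rw [eval_C_mul, eval_sumHessian_affineLine, Finset.sdiff_singleton_eq_erase, mul_comm]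

lemma eval_derivative_derivative_sumHessian (α : ℝ) (j : ℤ) (lam ξ : Fin n → ℝ) :
    (derivative (derivative (sumHessian α Finset.univ j (affineLine lam ξ)))).eval 0 =
      ∑ p : Fin n, ∑ q ∈ Finset.univ.erase p,
        Ssum α (Finset.univ \ {p, q}) (j - 2) lam * ξ p * ξ q := by
  simp only [derivative_sumHessian_affineLine, derivative_sum, derivative_C_mul, eval_finsetSum,
    eval_C_mul, eval_sumHessian_affineLine, Finset.mul_sum]
  refine Finset.sum_congr rfl fun p _ => Finset.sum_congr rfl fun q _ => ?_
  have hset : (Finset.univ.erase p).erase q = Finset.univ \ {p, q} := by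
    ext i
    simp [and_comm]
  rw [hset, show j - 1 - 1 = j - 2 by ring]
  ring

end Jets

/-- Lemma 2.4: the two concavity inequalities comparing `S_k` and `S_l` for `l < k`. -/
theorem concavity_Sk_Sl {n k l : ℕ} (α : ℝ) (hα : 0 ≤ α)
    (hl1 : 1 ≤ l) (hlk : l < k) (hkn : k ≤ n)
    (lam : Fin n → ℝ) (hlam : lam ∈ GammaTilde n k α) (ξ : Fin n → ℝ)
    (ϑ Sk Sl Ak Al Qk Ql : ℝ)
    (hϑ : ϑ = 1 / ((k : ℝ) - (l : ℝ)))
    (hSk : Sk = Ssum α Finset.univ (k : ℤ) lam)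
    (hSl : Sl = Ssum α Finset.univ (l : ℤ) lam)
    (hAk : Ak = ∑ p : Fin n, Ssum α (Finset.univ \ {p}) ((k : ℤ) - 1) lam * ξ p)
    (hAl : Al = ∑ p : Fin n, Ssum α (Finset.univ \ {p}) ((l : ℤ) - 1) lam * ξ p)
    (hQk : Qk = ∑ p : Fin n, ∑ q ∈ Finset.univ.erase p,
        Ssum α (Finset.univ \ {p, q}) ((k : ℤ) - 2) lam * ξ p * ξ q)
    (hQl : Ql = ∑ p : Fin n, ∑ q ∈ Finset.univ.erase p,
        Ssum α (Finset.univ \ {p, q}) ((l : ℤ) - 2) lam * ξ p * ξ q) :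
    (-(Qk / Sk) + Ql / Sl
        ≥ (Ak / Sk - Al / Sl) * ((ϑ - 1) * (Ak / Sk) - (ϑ + 1) * (Al / Sl))) ∧
    (∀ δ : ℝ, 0 < δ → δ < 1 →
      -Qk + (1 - ϑ + ϑ / δ) * Ak ^ 2 / Sk
        ≥ Sk * (ϑ + 1 - δ * ϑ) * (Al / Sl) ^ 2 - (Sk / Sl) * Ql) := by
  set x := affineLine lam ξ with hx
  set T : ℕ → ℝ[X] := fun j => sumHessian α Finset.univ (j : ℤ) x with hT
  obtain ⟨hG, hSpos⟩ := hlam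
  have hσ : ∀ j : ℕ, j ≤ k - 1 → 0 < (intEsymm Finset.univ (j : ℤ) x).eval 0 := by
    intro j hj
    rcases Nat.eq_zero_or_pos j with rfl | h0
    · simp
    · rw [eval_intEsymm_affineLine]
      exact hG j h0 hj
  have hTpos : ∀ j : ℕ, 1 ≤ j → j ≤ k → 0 < (T j).eval 0 := by
    intro j h1 hj
    rcases hj.eq_or_lt with rfl | hlt
    · rw [hT, eval_sumHessian_affineLine]
      exact hSpos
    · obtain ⟨m, rfl⟩ := Nat.exists_eq_add_of_le' h1
      have h2 := hσ m (by omega)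
      have h3 := hσ (m + 1) (by omega)
      simp only [hT, sumHessian]
      rw [show ((m + 1 : ℕ) : ℤ) - 1 = m by omega, eval_add, eval_C_mul]
      positivity
  have hstep : ∀ j, l ≤ j → j < l + (k - l) →
      ((derivative (T (j + 1))).eval 0 / (T (j + 1)).eval 0
          - (derivative (T j)).eval 0 / (T j).eval 0) ^ 2 ≤
        ((derivative (derivative (T j))).eval 0 / (T j).eval 0
          - ((derivative (T j)).eval 0 / (T j).eval 0) ^ 2) -
        ((derivative (derivative (T (j + 1)))).eval 0 / (T (j + 1)).eval 0
          - ((derivative (T (j + 1))).eval 0 / (T (j + 1)).eval 0) ^ 2) := by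
    intro j hlj hjk
    have hu := hTpos (j + 1) (by omega) (by omega)
    have hv := hTpos j (by omega) (by omega)
    have hq : quotSecond (T j) (T (j + 1)) ≤ 0 := by
      have := quotSecond_sumHessian_nonpos hα Finset.univ x
        (fun i => by simp [hx, derivative_affineLine]) (k := j) (by omega)
        (fun i hi => hσ i (by omega)) (by exact_mod_cast hu)
      exact_mod_cast this
    rw [← sub_nonneg]
    have hd : 0 ≤ -quotSecond (T j) (T (j + 1)) / ((T j).eval 0 ^ 2 * (T (j + 1)).eval 0) :=
      div_nonneg (neg_nonneg.2 hq) (by positivity)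
    refine hd.trans_eq ?_
    simp only [quotSecond]
    field_simp
    ring
  have hmain := sq_sub_le_mul_sub_of_step
    (fun j => (derivative (T j)).eval 0 / (T j).eval 0)
    (fun j => (derivative (derivative (T j))).eval 0 / (T j).eval 0) l (k - l) hstep
  simp only [Nat.add_sub_cancel' hlk.le, hT, hx, eval_sumHessian_affineLine,
    eval_derivative_sumHessian, eval_derivative_derivative_sumHessian] at hmain
  rw [← hSk, ← hSl, ← hAk, ← hAl, ← hQk, ← hQl, Nat.cast_sub hlk.le] at hmain
  have hSk0 : 0 < Sk := hSk ▸ hSpos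
  have hd : (0 : ℝ) < (k : ℝ) - l := sub_pos.2 (by exact_mod_cast hlk)
  have hϑ0 : 0 < ϑ := hϑ ▸ one_div_pos.2 hd
  have ha : ϑ * (Ak / Sk - Al / Sl) ^ 2 ≤
      (Ql / Sl - (Al / Sl) ^ 2) - (Qk / Sk - (Ak / Sk) ^ 2) := by
    rw [hϑ, one_div_mul_eq_div, div_le_iff₀' hd]
    exact hmain
  refine ⟨by linarith, fun δ hδ0 _ => ?_⟩
  have hb := mul_le_mul_of_nonneg_left ha hSk0.le
  have hsq : 0 ≤ Sk * ϑ * (δ * (Al / Sl - Ak / Sk / δ) ^ 2) := by positivity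
  have e1 : Sk * (Qk / Sk) = Qk := mul_div_cancel₀ Qk hSk0.ne'
  have e2 : (1 - ϑ + ϑ / δ) * Ak ^ 2 / Sk = Sk * ((1 - ϑ + ϑ / δ) * (Ak / Sk) ^ 2) := by
    field_simp
  have e3 : Sk * ϑ * (δ * (Al / Sl - Ak / Sk / δ) ^ 2) =
      Sk * (ϑ * δ * (Al / Sl) ^ 2 - 2 * ϑ * (Al / Sl) * (Ak / Sk) + ϑ / δ * (Ak / Sk) ^ 2) := by
    generalize Al / Sl = b
    generalize Ak / Sk = a
    field_simp
    ring
  have e4 : Sk / Sl * Ql = Sk * (Ql / Sl) := by ring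
  rw [e2, e4]
  rw [e3] at hsq
  linarith
end

section
/- Let α ≥ 0, let 2 ≤ k ≤ n, and let F ≥ 0, G ≥ 0. There exists a constant K > 0, depending only on n, k, F, G, α, such that for every λ = (λ_1,…,λ_n) ∈ Γ̃_k with λ_1 ≥ λ_2 ≥ ⋯ ≥ λ_n satisfying σ_{k−1}(λ) + α·σ_k(λ) ≤ F and σ_k(λ) ≥ −G, one has λ_n ≥ −K. -/
open Finset

open Polynomial in
/-- The derivative of a real-rooted polynomial is real-rooted. -/
theorem splits_derivative_of_splits_s12 {f : ℝ[X]} (hf : f.Splits) : (derivative f).Splits := by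
  rw [splits_iff_card_roots] at hf ⊢
  have h₁ := card_roots_le_derivative f
  have h₂ := (derivative f).card_roots'
  have h₃ := natDegree_derivative_le f
  omega

open Polynomial in
/-- Laguerre's inequality at the origin for a real-rooted polynomial. -/
theorem two_mul_coeff_zero_mul_coeff_two_le_sq {f : ℝ[X]} (hf : f.Splits) :
    2 * (f.coeff 0 * f.coeff 2) ≤ f.coeff 1 ^ 2 := by
  have key (m : Multiset ℝ) : 2 * ((m.map (X + C ·)).prod.coeff 0 * (m.map (X + C ·)).prod.coeff 2)
      ≤ (m.map (X + C ·)).prod.coeff 1 ^ 2 := by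
    induction m using Multiset.induction_on with
    | empty => simp [coeff_one]
    | cons r m ih =>
      simp only [Multiset.map_cons, Multiset.prod_cons, add_mul, coeff_add, coeff_C_mul,
        coeff_X_mul, coeff_X_mul_zero]
      nlinarith [mul_le_mul_of_nonneg_left ih (sq_nonneg r),
        sq_nonneg ((m.map (X + C ·)).prod.coeff 0)]
  obtain ⟨m, hm⟩ := splits_iff_exists_multiset'.mp hf
  rw [hm]
  simp only [coeff_C_mul]
  nlinarith [mul_le_mul_of_nonneg_left (key m) (sq_nonneg f.leadingCoeff)]

open Polynomial in
/-- A Newton inequality for three consecutive coefficients of a real-rooted polynomial. -/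
theorem coeff_newton {f : ℝ[X]} (hf : f.Splits) (M : ℕ) :
    (M + 2 : ℝ) * (f.coeff M * f.coeff (M + 2)) ≤ (M + 1) * f.coeff (M + 1) ^ 2 := by
  have hs : (derivative^[M] f).Splits :=
    Function.Iterate.rec (fun g : ℝ[X] => g.Splits) hf
      (fun _ hg => splits_derivative_of_splits_s12 hg) M
  have h := two_mul_coeff_zero_mul_coeff_two_le_sq hs
  simp only [coeff_iterate_derivative, nsmul_eq_mul, zero_add, add_comm 1 M, add_comm 2 M,
    Nat.descFactorial_self] at h
  have h₁ : ((M + 1).descFactorial M : ℝ) = (M + 1) * M.factorial := by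
    have := Nat.factorial_mul_descFactorial (Nat.le_add_right M 1)
    simp only [Nat.add_sub_cancel_left, Nat.factorial_one, one_mul] at this
    rw [this, Nat.factorial_succ]
    push_cast
    ring
  have h₂ : 2 * ((M + 2).descFactorial M : ℝ) = (M + 2) * ((M + 1) * M.factorial) := by
    have := Nat.factorial_mul_descFactorial (Nat.le_add_right M 2)
    simp only [Nat.add_sub_cancel_left, Nat.factorial_succ] at this
    exact_mod_cast this
  rw [h₁] at h
  have hpos : (0 : ℝ) < (M + 1) * (M.factorial : ℝ) ^ 2 := by positivity
  refine le_of_mul_le_mul_left ?_ hpos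
  linear_combination h - M.factorial * (f.coeff M * f.coeff (M + 2)) * h₂

theorem esigma_natCast {n : ℕ} (A : Finset (Fin n)) (j : ℕ) (lam : Fin n → ℝ) :
    esigma A (j : ℤ) lam = ∑ s ∈ A.powersetCard j, ∏ i ∈ s, lam i := by
  simp [esigma]

/-- Newton's inequality for elementary symmetric polynomials, with a constant that does not
depend on the order. -/
theorem esigma_newton {n : ℕ} (A : Finset (Fin n)) (p : ℕ) (lam : Fin n → ℝ) :
    (#A + 2 : ℝ) * (esigma A (p : ℕ) lam * esigma A (p + 2 : ℕ) lam) ≤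
      (#A + 1) * esigma A (p + 1 : ℕ) lam ^ 2 := by
  by_cases hp : p + 2 ≤ #A
  · obtain ⟨M, hM⟩ := Nat.exists_eq_add_of_le hp
    have hs : (∏ i ∈ A, (Polynomial.X + Polynomial.C (lam i))).Splits :=
      Polynomial.Splits.prod fun i _ => Polynomial.Splits.X_add_C _
    have h := coeff_newton hs M
    rw [Finset.prod_X_add_C_coeff _ _ (by omega), Finset.prod_X_add_C_coeff _ _ (by omega),
      Finset.prod_X_add_C_coeff _ _ (by omega), show #A - M = p + 2 by omega,
      show #A - (M + 1) = p + 1 by omega, show #A - (M + 2) = p by omega,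
      ← esigma_natCast, ← esigma_natCast, ← esigma_natCast] at h
    have hMA : (M : ℝ) ≤ #A := by exact_mod_cast (by omega : M ≤ #A)
    set x := esigma A (p : ℕ) lam * esigma A (p + 2 : ℕ) lam with hx
    set b := esigma A (p + 1 : ℕ) lam
    rw [mul_comm (esigma A (p + 2 : ℕ) lam), ← hx] at h
    have hM2 : (0 : ℝ) < M + 2 := by positivity
    refine le_of_mul_le_mul_left ?_ hM2
    nlinarith [mul_le_mul_of_nonneg_left h (by positivity : (0 : ℝ) ≤ #A + 2),
      mul_nonneg (sub_nonneg.mpr hMA) (sq_nonneg b)]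
  · have h0 : esigma A (p + 2 : ℕ) lam = 0 := by
      rw [esigma_natCast, Finset.powersetCard_eq_empty.mpr (by omega), Finset.sum_empty]
    rw [h0]
    simp only [mul_zero]
    positivity

/-- Expansion of an elementary symmetric polynomial along one variable. -/
theorem esigma_univ_succ {n : ℕ} (x : Fin n) (j : ℕ) (lam : Fin n → ℝ) :
    esigma univ (j + 1 : ℕ) lam =
      esigma (univ.erase x) (j + 1 : ℕ) lam + lam x * esigma (univ.erase x) (j : ℕ) lam := by
  simp only [esigma_natCast]
  conv_lhs => rw [← Finset.insert_erase (Finset.mem_univ x)]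
  have hx : x ∉ univ.erase x := Finset.notMem_erase x univ
  rw [Finset.powersetCard_succ_insert hx, Finset.sum_union, Finset.sum_image, Finset.mul_sum]
  · congr 1
    refine Finset.sum_congr rfl fun s hs => Finset.prod_insert fun h => hx ?_
    exact (Finset.mem_powersetCard.mp hs).1 h
  · intro s hs t ht hst
    have hs' : x ∉ s := fun h => hx ((Finset.mem_powersetCard.mp hs).1 h)
    have ht' : x ∉ t := fun h => hx ((Finset.mem_powersetCard.mp ht).1 h)
    rw [← Finset.erase_insert hs', ← Finset.erase_insert ht', hst]
  · rw [Finset.disjoint_left]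
    intro s hs hs'
    obtain ⟨t, -, rfl⟩ := Finset.mem_image.mp hs'
    exact hx ((Finset.mem_powersetCard.mp hs).1 (Finset.mem_insert_self x t))

/-- On `Γ_k`, a negative entry forces the elementary symmetric polynomials of the remaining
entries to grow geometrically. -/
theorem pow_le_esigma_erase {n k : ℕ} {lam : Fin n → ℝ} (hlam : lam ∈ Gamma n k) {x : Fin n}
    (hx : lam x ≤ 0) {j : ℕ} (hj : j ≤ k) :
    (-lam x) ^ j ≤ esigma (univ.erase x) (j : ℕ) lam := by
  induction j with
  | zero => simp [esigma]
  | succ j ih =>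
    have h := hlam (j + 1) (by omega) hj
    rw [esigma_univ_succ x] at h
    have := mul_le_mul_of_nonneg_left (ih (by omega)) (neg_nonneg.mpr hx)
    rw [pow_succ']
    linarith

/-- Lemma 2.6: if `λ ∈ Γ̃_k` is ordered, `σ_{k-1} + α σ_k ≤ F` and `σ_k ≥ -G`,
then `λ_n ≥ -K` for a constant `K = K(n,k,F,G,α) > 0`. -/
theorem lambda_min_lower_bound {n k : ℕ} (α F G : ℝ) (hα : 0 ≤ α) (hF : 0 ≤ F)
    (hG : 0 ≤ G) (hk2 : 2 ≤ k) (hkn : k ≤ n) :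
    ∃ K : ℝ, 0 < K ∧ ∀ lam : Fin n → ℝ, lam ∈ GammaTilde n k α → Antitone lam →
      Ssum α Finset.univ (k : ℤ) lam ≤ F →
      -G ≤ esigma Finset.univ (k : ℤ) lam →
      -K ≤ lam ⟨n - 1, by omega⟩ := by
  obtain ⟨p, rfl⟩ := Nat.exists_eq_add_of_le' hk2
  have hC : 0 ≤ F + α * G := by positivity
  refine ⟨1 + (n + 1) * (F + α * G + G), by positivity, ?_⟩
  rintro lam ⟨hΓ, -⟩ - hSF hσG
  set x : Fin n := ⟨n - 1, by omega⟩
  replace hΓ : lam ∈ Gamma n (p + 1) := hΓ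
  by_contra! hlt
  have hK : 0 ≤ (n + 1) * (F + α * G + G) := by positivity
  have hm : 1 ≤ -lam x := by linarith
  have hb := pow_le_esigma_erase hΓ (by linarith : lam x ≤ 0) le_rfl
  have ha := pow_le_esigma_erase hΓ (by linarith : lam x ≤ 0) p.le_succ
  have hpos := hΓ (p + 1) (by omega) le_rfl
  have hN := esigma_newton (univ.erase x) p lam
  have hcard : (#(univ.erase x) : ℝ) + 1 = n := by
    rw [← Nat.cast_add_one, Finset.card_erase_add_one (Finset.mem_univ x), Finset.card_univ,
      Fintype.card_fin]
  have hS : esigma univ (p + 1 : ℕ) lam ≤ F + α * G := by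
    have hidx : (((p + 2 : ℕ) : ℤ) - 1) = ((p + 1 : ℕ) : ℤ) := by push_cast; ring
    rw [Ssum, hidx] at hSF
    nlinarith [mul_le_mul_of_nonneg_left hσG hα]
  rw [esigma_univ_succ x] at hpos hS hσG
  rw [show (#(univ.erase x) : ℝ) + 2 = n + 1 by linarith, hcard] at hN
  have hmb : -lam x ≤ (-lam x) ^ (p + 1) := le_self_pow₀ hm (by omega)
  have ha0 : 1 ≤ (-lam x) ^ p := one_le_pow₀ hm
  set a := esigma (univ.erase x) (p : ℕ) lam
  set b := esigma (univ.erase x) (p + 1 : ℕ) lam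
  set d := esigma (univ.erase x) (p + 2 : ℕ) lam
  set m := -lam x with hm_def
  rw [show lam x = -m by simp [m]] at hpos hS hσG
  have hab : a ≤ b := by nlinarith
  have hb0 : 0 < b := by linarith
  have hupper : m * a * b ≤ G * a + a * d := by nlinarith
  have hlower : (b - (F + α * G)) * b ≤ m * a * b :=
    mul_le_mul_of_nonneg_right (by linarith) hb0.le
  have hGa : G * a ≤ G * b := mul_le_mul_of_nonneg_left hab hG
  have hn : (0 : ℝ) ≤ n + 1 := by positivity
  have hsq : b * b ≤ ((n + 1) * (F + α * G + G)) * b := by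
    nlinarith [mul_le_mul_of_nonneg_left (hlower.trans (hupper.trans
      (add_le_add_left hGa (a * d)))) hn]
  linarith [le_of_mul_le_mul_right hsq hb0]
end

section
/- Let n ≥ 3, let α be a constant, and let λ = (λ_1,…,λ_n) ∈ ℝ^n. Then for every index j ≠ 1, the following algebraic identity holds: S_n^{jj}(λ)·(−S_n^{jj}(λ) + 2·λ_1·S_n^{11,jj}(λ) + S_n^{11}(λ)) = λ_1²·S_{n−2}(λ|1j)² + S_n(λ)·S_{n−2}(λ|1j), where S_n^{jj}(λ) = S_{n−1}(λ|j), S_n^{11}(λ) = S_{n−1}(λ|1) and S_n^{11,jj}(λ) = S_{n−2}(λ|1j). -/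
open Finset

/-- Recursion of the elementary symmetric polynomials when one variable is added. -/
theorem esigma_insert {n : ℕ} {A : Finset (Fin n)} {a : Fin n} (ha : a ∉ A) (j : ℤ)
    (lam : Fin n → ℝ) :
    esigma (insert a A) j lam = esigma A j lam + lam a * esigma A (j - 1) lam := by
  rcases lt_or_ge j 0 with hj | hj
  · simp [esigma, hj.not_ge, show ¬ 1 ≤ j by omega]
  obtain ⟨k, rfl⟩ := Int.eq_ofNat_of_zero_le hj
  cases k with
  | zero => simp [esigma]
  | succ k =>
    have hk : ((k + 1 : ℕ) : ℤ) - 1 = (k : ℕ) := by push_cast; ring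
    have hnotin : ∀ s ∈ A.powersetCard k, a ∉ s := fun s hs has =>
      ha ((mem_powersetCard.mp hs).1 has)
    rw [hk]
    simp only [esigma, Int.natCast_nonneg, if_true, Int.toNat_natCast]
    rw [powersetCard_succ_insert ha, sum_union, sum_image, mul_sum]
    · congr 1
      exact sum_congr rfl fun s hs => prod_insert (hnotin s hs)
    · intro s hs t ht hst
      rw [← erase_insert (hnotin s hs), ← erase_insert (hnotin t ht)]
      exact congrArg (fun u => u.erase a) hst
    · rw [disjoint_left]
      intro s hs hs'
      obtain ⟨t, -, rfl⟩ := mem_image.mp hs'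
      exact ha ((mem_powersetCard.mp hs).1 (mem_insert_self a t))

theorem esigma_eq_zero_of_card_lt {n : ℕ} {A : Finset (Fin n)} {j : ℤ} (h : (#A : ℤ) < j)
    (lam : Fin n → ℝ) : esigma A j lam = 0 := by
  rw [esigma, powersetCard_eq_empty.mpr (by omega), sum_empty, ite_self]

theorem Ssum_insert {n : ℕ} (α : ℝ) {A : Finset (Fin n)} {a : Fin n} (ha : a ∉ A) (j : ℤ)
    (lam : Fin n → ℝ) :
    Ssum α (insert a A) j lam = Ssum α A j lam + lam a * Ssum α A (j - 1) lam := by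
  simp only [Ssum, esigma_insert ha]
  ring

theorem Ssum_eq_zero_of_card_add_one_lt {n : ℕ} (α : ℝ) {A : Finset (Fin n)} {j : ℤ}
    (h : (#A : ℤ) + 1 < j) (lam : Fin n → ℝ) : Ssum α A j lam = 0 := by
  rw [Ssum, esigma_eq_zero_of_card_lt (by omega), esigma_eq_zero_of_card_lt (by omega)]
  ring

/-- Lemma 3.1 (i): the algebraic identity
`S_n^{jj}(-S_n^{jj} + 2 λ_1 S_n^{11,jj} + S_n^{11}) = λ_1² S_{n-2}(λ|1j)² + S_n S_{n-2}(λ|1j)`. -/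
theorem Sn_identity_i {n : ℕ} (hn : 3 ≤ n) (α : ℝ) (lam : Fin n → ℝ)
    (j : Fin n) (hj : j ≠ ⟨0, by omega⟩) :
    Ssum α (Finset.univ \ {j}) ((n : ℤ) - 1) lam
        * (-(Ssum α (Finset.univ \ {j}) ((n : ℤ) - 1) lam)
            + 2 * lam ⟨0, by omega⟩
              * Ssum α (Finset.univ \ {(⟨0, by omega⟩ : Fin n), j}) ((n : ℤ) - 2) lam
            + Ssum α (Finset.univ \ {(⟨0, by omega⟩ : Fin n)}) ((n : ℤ) - 1) lam)
      = (lam ⟨0, by omega⟩) ^ 2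
          * (Ssum α (Finset.univ \ {(⟨0, by omega⟩ : Fin n), j}) ((n : ℤ) - 2) lam) ^ 2
        + Ssum α Finset.univ (n : ℤ) lam
          * Ssum α (Finset.univ \ {(⟨0, by omega⟩ : Fin n), j}) ((n : ℤ) - 2) lam := by
  generalize (⟨0, by omega⟩ : Fin n) = i at hj ⊢
  set B : Finset (Fin n) := univ \ {i, j} with hB
  have hiB : i ∉ B := by simp [hB]
  have hjB : j ∉ B := by simp [hB]
  have hj_compl : univ \ {j} = insert i B := by
    ext k; simp only [hB, mem_sdiff, mem_univ, mem_insert, mem_singleton]; grind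
  have hi_compl : univ \ {i} = insert j B := by
    ext k; simp only [hB, mem_sdiff, mem_univ, mem_insert, mem_singleton]; grind
  have huniv : (univ : Finset (Fin n)) = insert j (insert i B) := by
    ext k; simp only [hB, mem_sdiff, mem_univ, mem_insert, mem_singleton]; grind
  have hjiB : j ∉ insert i B := by simp [hj, hjB]
  have hcard : n = #B + 2 := by
    have h := congrArg card huniv
    rw [card_insert_of_notMem hjiB, card_insert_of_notMem hiB, card_univ, Fintype.card_fin] at h
    omega
  have hvanish : Ssum α B (n : ℤ) lam = 0 :=
    Ssum_eq_zero_of_card_add_one_lt α (by omega) lam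
  rw [hj_compl, hi_compl, huniv]
  simp only [Ssum_insert α hjiB, Ssum_insert α hiB, Ssum_insert α hjB, hvanish,
    show (n : ℤ) - 1 - 1 = n - 2 by ring]
  ring
end

section
/- Let n ≥ 3, let α ≥ 0, and let λ = (λ_1,…,λ_n) ∈ Γ̃_n with λ_1 ≥ λ_2 ≥ ⋯ ≥ λ_n. Then for every ξ = (ξ_1,…,ξ_n) ∈ ℝ^n the quadratic form satisfies Σ_{j>1} S_{n−2}(λ|1j)·ξ_j² − Σ_{p,q>1, p≠q} σ_{n−3}(λ|1pq)·ξ_p·ξ_q ≥ 0. -/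
open Finset

/-- The top elementary symmetric polynomial is the product of all entries. -/
lemma esigma_of_eq_card {n : ℕ} (A : Finset (Fin n)) (j : ℤ) (lam : Fin n → ℝ)
    (hj : j = #A) : esigma A j lam = ∏ i ∈ A, lam i := by
  subst hj
  simp [esigma]

lemma esigma_of_add_one_eq_card {n : ℕ} (A : Finset (Fin n)) (j : ℤ) (lam : Fin n → ℝ)
    (hA : A.Nonempty) (hj : j + 1 = #A) :
    esigma A j lam = ∑ i ∈ A, ∏ k ∈ A.erase i, lam k := by
  have hpos : 0 < #A := hA.card_pos
  obtain ⟨m, rfl⟩ : ∃ m : ℕ, j = m := ⟨#A - 1, by omega⟩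
  have hm : m + 1 = #A := by exact_mod_cast hj
  simp only [esigma, Int.natCast_nonneg, if_true, Int.toNat_natCast]
  symm
  refine Finset.sum_bij (fun i _ => A.erase i) ?_ ?_ ?_ ?_
  · intro i hi
    rw [mem_powersetCard]
    exact ⟨erase_subset _ _, by rw [card_erase_of_mem hi]; omega⟩
  · intro i hi k hk h
    exact (erase_inj A hi).1 h
  · intro s hs
    rw [mem_powersetCard] at hs
    obtain ⟨i, hi⟩ : ∃ i, A \ s = {i} := by
      rw [← card_eq_one, card_sdiff_of_subset hs.1]; omega
    have hiA : i ∈ A \ s := by simp [hi]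
    refine ⟨i, (mem_sdiff.1 hiA).1, ?_⟩
    rw [erase_eq, ← hi, Finset.sdiff_sdiff_eq_self hs.1]
  · intro i hi
    rfl

lemma prod_erase_eq_prod_mul_inv {n : ℕ} {A : Finset (Fin n)} {lam : Fin n → ℝ} {i : Fin n}
    (hi : i ∈ A) (h : lam i ≠ 0) :
    ∏ k ∈ A.erase i, lam k = (∏ k ∈ A, lam k) * (lam i)⁻¹ := by
  rw [← mul_prod_erase A lam hi]
  field_simp

lemma esigma_of_add_one_eq_card_of_ne_zero {n : ℕ} (A : Finset (Fin n)) (j : ℤ)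
    (lam : Fin n → ℝ) (hA : A.Nonempty) (hj : j + 1 = #A) (h : ∀ i ∈ A, lam i ≠ 0) :
    esigma A j lam = (∏ i ∈ A, lam i) * ∑ i ∈ A, (lam i)⁻¹ := by
  rw [esigma_of_add_one_eq_card A j lam hA hj, mul_sum]
  exact sum_congr rfl fun i hi => prod_erase_eq_prod_mul_inv hi (h i hi)

/-- The next-to-top elementary symmetric polynomial of `insert l A`, where the entry at `l` may
vanish. -/
lemma esigma_insert_s17 {n : ℕ} {A : Finset (Fin n)} {l : Fin n} (hl : l ∉ A) (j : ℤ)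
    (lam : Fin n → ℝ) (hj : j = #A) (h : ∀ i ∈ A, lam i ≠ 0) :
    esigma (insert l A) j lam = (∏ i ∈ A, lam i) * (1 + lam l * ∑ i ∈ A, (lam i)⁻¹) := by
  rw [esigma_of_add_one_eq_card _ j lam (insert_nonempty _ _)
    (by rw [card_insert_of_notMem hl]; push_cast; omega), sum_insert hl, erase_insert hl,
    mul_add, mul_one, mul_left_comm, mul_sum, mul_sum]
  congr 1
  refine sum_congr rfl fun i hi => ?_
  have hne : l ≠ i := fun e => hl (e ▸ hi)
  rw [erase_insert_of_ne hne, prod_insert (by simp [hl]),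
    prod_erase_eq_prod_mul_inv hi (h i hi)]

lemma Ssum_insert_s17 {n : ℕ} (α : ℝ) {A : Finset (Fin n)} {l : Fin n} (hl : l ∉ A) (j : ℤ)
    (lam : Fin n → ℝ) (hj : j = #A + 1) (h : ∀ i ∈ A, lam i ≠ 0) :
    Ssum α (insert l A) j lam
      = (∏ i ∈ A, lam i) * (1 + lam l * (∑ i ∈ A, (lam i)⁻¹ + α)) := by
  rw [Ssum, esigma_insert_s17 hl (j - 1) lam (by omega) h, esigma_of_eq_card _ j lam
    (by rw [card_insert_of_notMem hl]; push_cast; omega), prod_insert hl]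
  ring

/-- On `Γ_{n-1}`, the derivative of `t ↦ ∏ (t + λ_i)` is positive at every `t ≥ 0`. -/
lemma sum_prod_erase_add_pos {n : ℕ} (hn : 1 ≤ n) {lam : Fin n → ℝ} (h : lam ∈ Gamma n (n - 1))
    {t : ℝ} (ht : 0 ≤ t) : 0 < ∑ i, ∏ k ∈ univ.erase i, (t + lam k) := by
  set f : Polynomial ℝ := ∏ i : Fin n, (Polynomial.X + Polynomial.C (lam i)) with hf
  have hcoeff : ∀ k < n, 0 < f.coeff (k + 1) := by
    intro k hk
    rw [hf, Finset.prod_X_add_C_coeff _ _ (by simp; omega)]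
    rcases Nat.eq_zero_or_pos (n - (k + 1)) with h0 | h0
    · simp [h0]
    · simpa [esigma] using h (n - (k + 1)) h0 (by omega)
  have hdeg : f.natDegree = n := by
    rw [hf, Polynomial.natDegree_prod_of_monic _ _ fun i _ => Polynomial.monic_X_add_C _]
    simp
  have heval : (Polynomial.derivative f).eval t = ∑ i, ∏ k ∈ univ.erase i, (t + lam k) := by
    rw [hf, Polynomial.derivative_prod_finset]
    simp [Polynomial.eval_finsetSum, Polynomial.eval_prod]
  rw [← heval, Polynomial.eval_eq_sum_range' (n := n)
    (by have := Polynomial.natDegree_derivative_le f; omega)]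
  refine sum_pos' (fun k hk => ?_) ⟨0, by simp; omega, ?_⟩
  · rw [Polynomial.coeff_derivative]
    have := hcoeff k (mem_range.1 hk)
    positivity
  · rw [Polynomial.coeff_derivative]
    have := hcoeff 0 (by omega)
    simpa using this

/-- An ordered element of `Γ_{n-1}` has at most one nonpositive entry, namely the last. -/
lemma pos_of_mem_Gamma_of_lt {n : ℕ} {lam : Fin n → ℝ} (h : lam ∈ Gamma n (n - 1))
    (hord : Antitone lam) {i l : Fin n} (hil : i < l) (hl : ∀ k, k ≤ l) : 0 < lam i := by
  by_contra! hi
  obtain ⟨m, hm⟩ : ∃ m : Fin n, m.val + 1 = l.val :=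
    ⟨⟨l.val - 1, by omega⟩, by simp; omega⟩
  have hm0 : lam m ≤ 0 := (hord (show i ≤ m by rw [Fin.le_def]; omega)).trans hi
  have hpos := sum_prod_erase_add_pos (by have := i.2; omega) h (neg_nonneg.2 hm0)
  rw [Finset.sum_eq_single m (fun b _ hb => prod_eq_zero (i := m) (by simp [hb.symm]) (by simp))
    (by simp)] at hpos
  have hlm : l ∈ univ.erase m := by
    simp only [mem_erase, mem_univ, and_true]
    rintro rfl
    omega
  rw [← mul_prod_erase _ _ hlm] at hpos
  have h1 : -lam m + lam l ≤ 0 := by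
    have := hord (show m ≤ l by rw [Fin.le_def]; omega)
    linarith
  have h2 : 0 ≤ ∏ k ∈ (univ.erase m).erase l, (-lam m + lam k) := by
    refine prod_nonneg fun k hk => ?_
    simp only [mem_erase, mem_univ, and_true, ne_eq] at hk
    have hkl := hl k
    have := hord (show k ≤ m by
      rw [Fin.le_def] at *
      have := hk.1
      rw [Fin.ext_iff] at this
      omega)
    linarith
  linarith [mul_nonpos_of_nonpos_of_nonneg h1 h2]

/-- The quadratic form, reduced to the weighted moments `X = Σ x`, `A = Σ x ξ²`, `M = Σ x ξ`. -/
lemma reduced_form_nonneg {X A M α y c : ℝ} (hX : 0 < X) (hα : 0 ≤ α) (hA : 0 ≤ A)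
    (hCS : M ^ 2 ≤ A * X) (hy : 0 ≤ 1 + y * (X + α)) :
    0 ≤ A * (1 + y * (X + α)) - y * M ^ 2 + (X + α) * c ^ 2 - 2 * M * c := by
  have hW : 0 < X + α := by linarith
  refine nonneg_of_mul_nonneg_right (a := X + α) ?_ hW
  have h1 : 0 ≤ (X + α) * A - M ^ 2 := by nlinarith [mul_nonneg hα hA]
  have h2 := mul_nonneg hy h1
  nlinarith [sq_nonneg ((X + α) * c - M)]

/-- Lemma 3.2: for ordered `λ ∈ Γ̃_n`, the quadratic form
`Σ_{j>1} S_{n-2}(λ|1j) ξ_j² - Σ_{p,q>1, p≠q} σ_{n-3}(λ|1pq) ξ_p ξ_q` is nonnegative. -/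
theorem quadratic_form_nonneg {n : ℕ} (hn : 3 ≤ n) (α : ℝ) (hα : 0 ≤ α)
    (lam : Fin n → ℝ) (hlam : lam ∈ GammaTilde n n α) (hord : Antitone lam)
    (ξ : Fin n → ℝ) :
    (∑ j ∈ Finset.univ.erase (⟨0, by omega⟩ : Fin n),
        Ssum α (Finset.univ \ {(⟨0, by omega⟩ : Fin n), j}) ((n : ℤ) - 2) lam * ξ j ^ 2)
      - ∑ p ∈ Finset.univ.erase (⟨0, by omega⟩ : Fin n),
          ∑ q ∈ (Finset.univ.erase (⟨0, by omega⟩ : Fin n)).erase p,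
            esigma (Finset.univ \ {(⟨0, by omega⟩ : Fin n), p, q}) ((n : ℤ) - 3) lam
              * ξ p * ξ q
    ≥ 0 := by
  set o : Fin n := ⟨0, by omega⟩ with ho
  set l : Fin n := ⟨n - 1, by omega⟩ with hl
  have hlast : ∀ k, k ≤ l := fun k => by rw [Fin.le_def, hl]; simp; omega
  have hol : o < l := by rw [Fin.lt_def, ho, hl]; simp; omega
  have hpos : ∀ i, i ≠ l → 0 < lam i := fun i hi =>
    pos_of_mem_Gamma_of_lt hlam.1 hord (lt_of_le_of_ne (hlast i) hi) hlast
  set B : Finset (Fin n) := (univ.erase o).erase l with hB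
  have hlB : l ∉ B := by simp [hB]
  have hoB : o ∉ B := by simp [hB]
  have hlo : l ∈ univ.erase o := by simp [hol.ne']
  have hins : univ.erase o = insert l B := (insert_erase hlo).symm
  have hcard : (#B : ℤ) = n - 2 := by
    have : #B = n - 2 := by
      rw [hB, card_erase_of_mem hlo, card_erase_of_mem (mem_univ _)]
      simp; omega
    omega
  have hBne : B.Nonempty := by
    rw [← card_pos]; omega
  have hneB : ∀ i ∈ B, i ≠ l := fun i hi e => hlB (e ▸ hi)
  have hposB : ∀ i ∈ B, 0 < lam i := fun i hi => hpos i (hneB i hi)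
  have hne0 : ∀ i ∈ B, lam i ≠ 0 := fun i hi => (hposB i hi).ne'
  set P := ∏ i ∈ B, lam i with hP
  have hPpos : 0 < P := prod_pos hposB
  set X := ∑ i ∈ B, (lam i)⁻¹ with hX
  have hXpos : 0 < X := sum_pos (fun i hi => inv_pos.2 (hposB i hi)) hBne
  set A := ∑ i ∈ B, (lam i)⁻¹ * ξ i ^ 2 with hA
  set M := ∑ i ∈ B, (lam i)⁻¹ * ξ i with hM
  have hApos : 0 ≤ A := sum_nonneg fun i hi =>
    mul_nonneg (inv_pos.2 (hposB i hi)).le (sq_nonneg _)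
  have hCS : M ^ 2 ≤ A * X := by
    refine sum_sq_le_sum_mul_sum_of_sq_le_mul B (fun i hi => ?_) (fun i hi => ?_) fun i hi => ?_
    · exact mul_nonneg (inv_pos.2 (hposB i hi)).le (sq_nonneg _)
    · exact (inv_pos.2 (hposB i hi)).le
    · exact le_of_eq (by ring)
  have hy : 0 ≤ 1 + lam l * (X + α) := by
    rcases le_or_gt 0 (lam l) with h0 | h0
    · positivity
    · have hS := hlam.2
      have huniv : (univ : Finset (Fin n)) = insert l (insert o B) := by
        rw [insert_comm, ← hins, insert_erase (mem_univ o)]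
      have hlB' : l ∉ insert o B := by simp [hlB, hol.ne']
      have ho0 := hpos o hol.ne
      simp only [Set.mem_ofPred_eq] at hS
      rw [huniv, Ssum_insert_s17 α hlB' _ lam
        (by rw [card_insert_of_notMem hoB]; push_cast; omega)
        (by simpa using ⟨ho0.ne', hne0⟩), prod_insert hoB, sum_insert hoB] at hS
      have h1 := pos_of_mul_pos_right hS (mul_pos ho0 hPpos).le
      have h2 := mul_neg_of_neg_of_pos h0 (inv_pos.2 ho0)
      nlinarith
  -- the coefficients of the form
  have hdiag : ∀ j ∈ B, Ssum α (univ \ {o, j}) ((n : ℤ) - 2) lam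
      = P * (lam j)⁻¹ * (1 + lam l * (X - (lam j)⁻¹ + α)) := by
    intro j hj
    have hset : univ \ {o, j} = insert l (B.erase j) := by
      rw [← erase_insert_of_ne (hneB j hj).symm, ← hins]
      ext k; simp; tauto
    have hlj : l ∉ B.erase j := by simp [hlB]
    rw [hset, Ssum_insert_s17 α hlj _ lam
      (by rw [card_erase_of_mem hj]; have := hBne.card_pos; omega)
      (fun i hi => hne0 i (mem_of_mem_erase hi)), prod_erase_eq_prod_mul_inv hj (hne0 j hj),
      ← add_sum_erase B (fun i => (lam i)⁻¹) hj |> eq_sub_of_add_eq']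
  have hdiagl : Ssum α (univ \ {o, l}) ((n : ℤ) - 2) lam = P * (X + α) := by
    have hset : univ \ {o, l} = B := by
      ext k; simp [hB]; tauto
    rw [hset, Ssum, esigma_of_add_one_eq_card_of_ne_zero B _ lam hBne (by omega) hne0,
      esigma_of_eq_card B _ lam hcard.symm]
    ring
  have hoff : ∀ p ∈ B, ∀ q ∈ B.erase p, esigma (univ \ {o, p, q}) ((n : ℤ) - 3) lam
      = lam l * P * (lam p)⁻¹ * (lam q)⁻¹ := by
    intro p hp q hq
    have hqB := mem_of_mem_erase hq
    have hset : univ \ {o, p, q} = insert l ((B.erase p).erase q) := by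
      rw [← erase_insert_of_ne (hneB q hqB).symm, ← erase_insert_of_ne (hneB p hp).symm, ← hins]
      ext k; simp; tauto
    have hlpq : l ∉ (B.erase p).erase q := by simp [hlB]
    have hc : #((B.erase p).erase q) + 2 = #B := by
      have h1 := card_erase_add_one hp
      have h2 := card_erase_add_one hq
      omega
    rw [hset, esigma_of_eq_card _ _ lam (by rw [card_insert_of_notMem hlpq]; push_cast; omega),
      prod_insert hlpq, prod_erase_eq_prod_mul_inv hq (hne0 q hqB),
      prod_erase_eq_prod_mul_inv hp (hne0 p hp)]
    ring
  have hoffl : ∀ p ∈ B, esigma (univ \ {o, p, l}) ((n : ℤ) - 3) lam = P * (lam p)⁻¹ := by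
    intro p hp
    have hset : univ \ {o, p, l} = B.erase p := by
      ext k; simp [hB]; tauto
    have hc := card_erase_add_one hp
    rw [hset, esigma_of_eq_card _ _ lam (by omega), prod_erase_eq_prod_mul_inv hp (hne0 p hp)]
  have hoffl' : ∀ q ∈ B, esigma (univ \ {o, l, q}) ((n : ℤ) - 3) lam = P * (lam q)⁻¹ := by
    intro q hq
    rw [pair_comm l q, hoffl q hq]
  have hrow : ∀ p ∈ B, ∑ q ∈ (insert l B).erase p,
      esigma (univ \ {o, p, q}) ((n : ℤ) - 3) lam * ξ p * ξ q
      = P * ((lam p)⁻¹ * ξ p) * ξ l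
        + lam l * P * ((lam p)⁻¹ * ξ p) * (M - (lam p)⁻¹ * ξ p) := by
    intro p hp
    rw [erase_insert_of_ne (hneB p hp).symm, sum_insert (by simp [hlB]), hoffl p hp,
      ← add_sum_erase B (fun i => (lam i)⁻¹ * ξ i) hp |> eq_sub_of_add_eq', mul_sum]
    congr 1
    · ring
    · refine sum_congr rfl fun q hq => ?_
      rw [hoff p hp q hq]
      ring
  have hrowl : ∑ q ∈ (insert l B).erase l,
      esigma (univ \ {o, l, q}) ((n : ℤ) - 3) lam * ξ l * ξ q = P * M * ξ l := by
    rw [erase_insert hlB, hM, mul_sum, sum_mul]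
    refine sum_congr rfl fun q hq => ?_
    rw [hoffl' q hq]
    ring
  have hform := mul_nonneg hPpos.le
    (reduced_form_nonneg (c := ξ l) hXpos hα hApos hCS hy)
  refine hform.trans_eq ?_
  rw [hins, sum_insert hlB, sum_insert hlB, hdiagl, hrowl, sum_congr rfl hrow,
    sum_congr rfl fun j hj => by rw [hdiag j hj]]
  have hsum : ∑ j ∈ B, P * (lam j)⁻¹ * (1 + lam l * (X - (lam j)⁻¹ + α)) * ξ j ^ 2
      - ∑ p ∈ B, (P * ((lam p)⁻¹ * ξ p) * ξ l
        + lam l * P * ((lam p)⁻¹ * ξ p) * (M - (lam p)⁻¹ * ξ p))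
      = P * (1 + lam l * (X + α)) * A - P * (ξ l + lam l * M) * M := by
    conv_rhs => rw [hA]
    conv_rhs =>
      enter [2, 2]
      rw [hM]
    rw [mul_sum, mul_sum, ← sum_sub_distrib, ← sum_sub_distrib]
    refine sum_congr rfl fun j _ => ?_
    ring
  linear_combination -hsum
end

section
/- Let n ≥ 3, let α ≥ 0, and let λ = (λ_1,…,λ_n) ∈ Γ̃_n with λ_1 ≥ λ_2 ≥ ⋯ ≥ λ_n. Then for every ξ = (ξ_1,…,ξ_n) ∈ ℝ^n, Σ_{j>1} S_{n−2}(λ|1j)²·ξ_j² + Σ_{p,q>1, p≠q} σ_{n−3}(λ|1pq)²·ξ_p·ξ_q ≥ 0. -/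
open Finset

open Polynomial in
/-- If all elementary symmetric sums of degree less than `#s` are positive, then
`∏ (X + r i)` has positive derivative on `[0, ∞)`. -/
lemma derivative_prod_X_add_C_eval_pos {ι : Type*} (s : Finset ι) (r : ι → ℝ)
    (hs : 0 < s.card)
    (h : ∀ j < s.card, 0 < ∑ t ∈ s.powersetCard j, ∏ i ∈ t, r i) {c : ℝ} (hc : 0 ≤ c) :
    0 < (derivative (∏ i ∈ s, (X + C (r i)))).eval c := by
  have hcoeff : ∀ k < s.card, 0 < (derivative (∏ i ∈ s, (X + C (r i)))).coeff k := by
    intro k hk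
    rw [coeff_derivative, Finset.prod_X_add_C_coeff s r (by omega)]
    have := h (s.card - (k + 1)) (by omega)
    positivity
  have hdeg : (∏ i ∈ s, (X + C (r i))).natDegree = s.card := by
    rw [natDegree_prod_of_monic _ _ fun i _ => monic_X_add_C (r i)]
    simp
  have hlt : (derivative (∏ i ∈ s, (X + C (r i)))).natDegree < s.card := by
    have := natDegree_derivative_lt (p := ∏ i ∈ s, (X + C (r i))) (by omega)
    omega
  rw [eval_eq_sum_range' hlt]
  refine Finset.sum_pos' (fun k hk => ?_) ⟨0, Finset.mem_range.2 hs, ?_⟩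
  · have := hcoeff k (Finset.mem_range.1 hk)
    positivity
  · simpa using hcoeff 0 hs

open Polynomial in
/-- If all elementary symmetric sums of degree less than `#s` are positive, at most one entry is
nonpositive. -/
lemma eq_of_nonpos_of_esymm_pos {ι : Type*} [DecidableEq ι] (s : Finset ι) (r : ι → ℝ)
    (h : ∀ j < s.card, 0 < ∑ t ∈ s.powersetCard j, ∏ i ∈ t, r i)
    {a b : ι} (ha : a ∈ s) (hb : b ∈ s) (hra : r a ≤ 0) (hrb : r b ≤ 0) : a = b := by
  by_contra hab
  have hs : 0 < s.card := Finset.card_pos.2 ⟨a, ha⟩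
  have hfac : ∏ i ∈ s, (X + C (r i)) =
      (X + C (r a)) * ((X + C (r b)) * ∏ i ∈ (s.erase a).erase b, (X + C (r i))) := by
    rw [Finset.mul_prod_erase (s.erase a) (fun i => X + C (r i))
      (Finset.mem_erase.2 ⟨Ne.symm hab, hb⟩), Finset.mul_prod_erase s (fun i => X + C (r i)) ha]
  have key : ∀ c : ℝ, 0 ≤ c → (derivative (∏ i ∈ s, (X + C (r i)))).eval c ≠ 0 := fun c hc =>
    (derivative_prod_X_add_C_eval_pos s r hs h hc).ne'
  have rolle : ∀ u v : ℝ, 0 ≤ u → u < v → (∏ i ∈ s, (X + C (r i))).eval u = 0 →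
      (∏ i ∈ s, (X + C (r i))).eval v = 0 → False := by
    intro u v hu huv h1 h2
    obtain ⟨c, hc, hd⟩ := exists_deriv_eq_zero huv
      (Polynomial.continuousOn (∏ i ∈ s, (X + C (r i)))) (h1.trans h2.symm)
    rw [Polynomial.deriv] at hd
    exact key c (hu.trans hc.1.le) hd
  have hza : (∏ i ∈ s, (X + C (r i))).eval (-r a) = 0 := by simp [hfac]
  have hzb : (∏ i ∈ s, (X + C (r i))).eval (-r b) = 0 := by simp [hfac]
  rcases lt_trichotomy (r a) (r b) with hlt | heq | hlt
  · exact rolle (-r b) (-r a) (by linarith) (by linarith) hzb hza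
  · refine key (-r a) (by linarith) ?_
    rw [hfac, heq]
    simp
  · exact rolle (-r a) (-r b) (by linarith) (by linarith) hza hzb

lemma sum_powersetCard_pred_prod {ι : Type*} [DecidableEq ι] (A : Finset ι) (r : ι → ℝ)
    (k : ℕ) (hk : A.card = k + 1) :
    ∑ s ∈ A.powersetCard k, ∏ i ∈ s, r i = ∑ j ∈ A, ∏ i ∈ A.erase j, r i := by
  symm
  refine Finset.sum_nbij (fun j => A.erase j) ?_ ?_ ?_ (fun _ _ => rfl)
  · intro j hj
    rw [Finset.mem_powersetCard, Finset.card_erase_of_mem hj]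
    exact ⟨Finset.erase_subset _ _, by omega⟩
  · exact Finset.erase_injOn A
  · intro s hs
    obtain ⟨hsA, hcard⟩ := Finset.mem_powersetCard.1 (Finset.mem_coe.1 hs)
    have h1 : (A \ s).card = 1 := by
      rw [Finset.card_sdiff_of_subset hsA]
      omega
    obtain ⟨j, hj⟩ := Finset.card_eq_one.1 h1
    have hjA : j ∈ A \ s := by simp [hj]
    refine ⟨j, (Finset.mem_sdiff.1 hjA).1, ?_⟩
    simp only
    rw [Finset.erase_eq, ← hj, Finset.sdiff_sdiff_eq_self hsA]

lemma esigma_card {n : ℕ} (A : Finset (Fin n)) (lam : Fin n → ℝ) {j : ℤ}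
    (hj : j = A.card) : esigma A j lam = ∏ i ∈ A, lam i := by
  subst hj
  simp [esigma]

lemma esigma_card_sub_one {n : ℕ} (A : Finset (Fin n)) (lam : Fin n → ℝ) {j : ℤ}
    (hj : j = (A.card : ℤ) - 1) (hA : 0 < A.card) :
    esigma A j lam = ∑ k ∈ A, ∏ i ∈ A.erase k, lam i := by
  have h0 : 0 ≤ j := by omega
  rw [esigma, if_pos h0, sum_powersetCard_pred_prod A lam j.toNat (by omega)]

lemma quadratic_form_nonneg_of_weights_nonneg {ι : Type*} [DecidableEq ι] (B : Finset ι)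
    (W : ι → ι → ℝ) (V ξ : ι → ℝ) (hsymm : ∀ p q, W p q = W q p)
    (hW : ∀ p ∈ B, ∀ q ∈ B.erase p, 0 ≤ W p q) (hV : ∀ p ∈ B, 0 ≤ V p) :
    0 ≤ ∑ j ∈ B, (∑ i ∈ B.erase j, W j i + V j) ^ 2 * ξ j ^ 2
      + ∑ p ∈ B, ∑ q ∈ B.erase p, W p q ^ 2 * ξ p * ξ q := by
  have hdiag : ∑ j ∈ B, ∑ i ∈ B.erase j, W j i ^ 2 * ξ j ^ 2 ≤
      ∑ j ∈ B, (∑ i ∈ B.erase j, W j i + V j) ^ 2 * ξ j ^ 2 := by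
    refine Finset.sum_le_sum fun j hj => ?_
    rw [← Finset.sum_mul]
    have h1 : ∑ i ∈ B.erase j, W j i ^ 2 ≤ (∑ i ∈ B.erase j, W j i) ^ 2 :=
      Finset.sum_sq_le_sq_sum_of_nonneg (hW j hj)
    have h2 : 0 ≤ ∑ i ∈ B.erase j, W j i := Finset.sum_nonneg (hW j hj)
    have h3 := hV j hj
    gcongr
    nlinarith [mul_nonneg h2 h3]
  have hswap : ∑ j ∈ B, ∑ i ∈ B.erase j, W j i ^ 2 * ξ j ^ 2 =
      ∑ j ∈ B, ∑ i ∈ B.erase j, W j i ^ 2 * ξ i ^ 2 := by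
    rw [Finset.sum_comm' (t' := B) (s' := fun i => B.erase i)
      (by intro x y; simp only [Finset.mem_erase]; tauto)]
    exact Finset.sum_congr rfl fun j _ => Finset.sum_congr rfl fun i _ => by rw [hsymm]
  have hsq : 0 ≤ ∑ j ∈ B, ∑ i ∈ B.erase j, W j i ^ 2 * (ξ j + ξ i) ^ 2 :=
    Finset.sum_nonneg fun j _ => Finset.sum_nonneg fun i _ => by positivity
  have hexp : ∑ j ∈ B, ∑ i ∈ B.erase j, W j i ^ 2 * (ξ j + ξ i) ^ 2 =
      ∑ j ∈ B, ∑ i ∈ B.erase j, W j i ^ 2 * ξ j ^ 2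
      + ∑ j ∈ B, ∑ i ∈ B.erase j, W j i ^ 2 * ξ i ^ 2
      + 2 * ∑ p ∈ B, ∑ q ∈ B.erase p, W p q ^ 2 * ξ p * ξ q := by
    simp only [Finset.mul_sum, ← Finset.sum_add_distrib]
    exact Finset.sum_congr rfl fun j _ => Finset.sum_congr rfl fun i _ => by ring
  linarith

/-- The weighted Cauchy–Schwarz estimate behind the case of one negative entry. -/
lemma mul_sq_sum_le_sum_of_pos {ι : Type*} (C : Finset ι) (y η : ι → ℝ) (t U : ℝ)
    (hy : ∀ j ∈ C, 0 < y j) (ht : 0 < t) (hU : 0 < U) (hYU : ∑ j ∈ C, y j ≤ U) :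
    t * (t + 2 * U) * (∑ j ∈ C, y j ^ 2 * η j) ^ 2 ≤
      U ^ 2 * ∑ j ∈ C, t * (t + 2 * y j) * y j ^ 2 * η j ^ 2 := by
  have hcs : (∑ j ∈ C, y j ^ 2 * η j) ^ 2 ≤ (∑ j ∈ C, y j) * ∑ j ∈ C, y j ^ 3 * η j ^ 2 := by
    refine Finset.sum_sq_le_sum_mul_sum_of_sq_le_mul C (fun j hj => (hy j hj).le)
      (fun j hj => ?_) (fun j _ => le_of_eq (by ring))
    have := hy j hj
    positivity
  have h0 : 0 ≤ ∑ j ∈ C, y j ^ 3 * η j ^ 2 := Finset.sum_nonneg fun j hj => by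
    have := hy j hj
    positivity
  have hterm : (t + 2 * U) * ∑ j ∈ C, y j ^ 3 * η j ^ 2 ≤
      U * ∑ j ∈ C, (t + 2 * y j) * y j ^ 2 * η j ^ 2 := by
    rw [Finset.mul_sum, Finset.mul_sum]
    refine Finset.sum_le_sum fun j hj => ?_
    have hyj := hy j hj
    have hle : y j ≤ U := (Finset.single_le_sum (fun i hi => (hy i hi).le) hj).trans hYU
    have : 0 ≤ t * (U - y j) * (y j ^ 2 * η j ^ 2) := by
      have := sub_nonneg.2 hle
      positivity
    linarith
  calc t * (t + 2 * U) * (∑ j ∈ C, y j ^ 2 * η j) ^ 2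
      ≤ t * (t + 2 * U) * (U * ∑ j ∈ C, y j ^ 3 * η j ^ 2) := by
        gcongr
        exact hcs.trans (by gcongr)
    _ = t * U * ((t + 2 * U) * ∑ j ∈ C, y j ^ 3 * η j ^ 2) := by ring
    _ ≤ t * U * (U * ∑ j ∈ C, (t + 2 * y j) * y j ^ 2 * η j ^ 2) := by gcongr
    _ = U ^ 2 * ∑ j ∈ C, t * (t + 2 * y j) * y j ^ 2 * η j ^ 2 := by
        simp only [Finset.mul_sum]
        exact Finset.sum_congr rfl fun j _ => by ring

/-- The quadratic form in the reciprocal variables `y`, when one of these is negative. -/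
lemma quadratic_form_nonneg_of_one_neg {ι : Type*} [DecidableEq ι] (B : Finset ι)
    (y ξ : ι → ℝ) (α : ℝ) (hα : 0 ≤ α) {m : ι} (hm : m ∈ B)
    (hy : ∀ j ∈ B.erase m, 0 < y j) (hne : (B.erase m).Nonempty)
    (hT : ∑ i ∈ B, y i + α < 0) :
    0 ≤ ∑ j ∈ B, (y j * (∑ i ∈ B.erase j, y i + α)) ^ 2 * ξ j ^ 2
      + ∑ p ∈ B, ∑ q ∈ B.erase p, (y p * y q) ^ 2 * ξ p * ξ q := by
  set C := B.erase m with hC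
  obtain ⟨t, ht⟩ : ∃ t, t = -(∑ i ∈ B, y i + α) := ⟨_, rfl⟩
  obtain ⟨U, hU⟩ : ∃ U, U = ∑ i ∈ C, y i + α := ⟨_, rfl⟩
  have ht0 : 0 < t := by linarith
  have hU0 : 0 < U := by
    have := Finset.sum_pos hy hne
    linarith
  have hsum : ∀ j ∈ B, ∑ i ∈ B.erase j, y i + α = -(t + y j) := fun j hj => by
    have := Finset.add_sum_erase B y hj
    linarith
  have hz : y m = -(t + U) := by
    have := hsum m hm
    rw [← hC] at this
    linarith
  have hoff : ∑ p ∈ B, ∑ q ∈ B.erase p, (y p * y q) ^ 2 * ξ p * ξ q =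
      (∑ p ∈ B, y p ^ 2 * ξ p) ^ 2 - ∑ p ∈ B, y p ^ 4 * ξ p ^ 2 := by
    rw [sq (∑ p ∈ B, y p ^ 2 * ξ p), Finset.sum_mul_sum, ← Finset.sum_sub_distrib]
    refine Finset.sum_congr rfl fun p hp => ?_
    rw [← Finset.add_sum_erase B _ hp]
    have : ∀ q, (y p * y q) ^ 2 * ξ p * ξ q = y p ^ 2 * ξ p * (y q ^ 2 * ξ q) := fun q => by ring
    simp only [this]
    ring
  have hdiag : ∑ j ∈ B, (y j * (∑ i ∈ B.erase j, y i + α)) ^ 2 * ξ j ^ 2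
      - ∑ p ∈ B, y p ^ 4 * ξ p ^ 2 = ∑ j ∈ B, t * (t + 2 * y j) * y j ^ 2 * ξ j ^ 2 := by
    rw [← Finset.sum_sub_distrib]
    refine Finset.sum_congr rfl fun j hj => ?_
    rw [hsum j hj]
    ring
  have hmain := mul_sq_sum_le_sum_of_pos C y ξ t U hy ht0 hU0 (by linarith)
  have hB : ∑ j ∈ B, t * (t + 2 * y j) * y j ^ 2 * ξ j ^ 2 =
      t * (t + 2 * y m) * y m ^ 2 * ξ m ^ 2 + ∑ j ∈ C, t * (t + 2 * y j) * y j ^ 2 * ξ j ^ 2 :=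
    (Finset.add_sum_erase B _ hm).symm
  have hH : ∑ p ∈ B, y p ^ 2 * ξ p = y m ^ 2 * ξ m + ∑ p ∈ C, y p ^ 2 * ξ p :=
    (Finset.add_sum_erase B _ hm).symm
  obtain ⟨H, hHdef⟩ : ∃ H, H = ∑ p ∈ C, y p ^ 2 * ξ p := ⟨_, rfl⟩
  obtain ⟨D, hDdef⟩ : ∃ D, D = ∑ j ∈ C, t * (t + 2 * y j) * y j ^ 2 * ξ j ^ 2 := ⟨_, rfl⟩
  rw [← hHdef, ← hDdef] at hmain
  rw [← hDdef, hz] at hB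
  rw [← hHdef, hz] at hH
  suffices h : 0 ≤ t * (t + 2 * -(t + U)) * (-(t + U)) ^ 2 * ξ m ^ 2 + D
      + ((-(t + U)) ^ 2 * ξ m + H) ^ 2 by
    rw [hoff, hH]
    linarith
  refine nonneg_of_mul_nonneg_right (a := U ^ 2) ?_ (by positivity)
  nlinarith [sq_nonneg (U ^ 2 * (t + U) * ξ m + (t + U) * H)]

/-- Remark 3.1: for ordered `λ ∈ Γ̃_n`,
`Σ_{j>1} S_{n-2}(λ|1j)² ξ_j² + Σ_{p,q>1, p≠q} σ_{n-3}(λ|1pq)² ξ_p ξ_q ≥ 0`. -/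
theorem quadratic_form_sq_nonneg {n : ℕ} (hn : 3 ≤ n) (α : ℝ) (hα : 0 ≤ α)
    (lam : Fin n → ℝ) (hlam : lam ∈ GammaTilde n n α) (hord : Antitone lam)
    (ξ : Fin n → ℝ) :
    (∑ j ∈ Finset.univ.erase (⟨0, by omega⟩ : Fin n),
        (Ssum α (Finset.univ \ {(⟨0, by omega⟩ : Fin n), j}) ((n : ℤ) - 2) lam) ^ 2
          * ξ j ^ 2)
      + ∑ p ∈ Finset.univ.erase (⟨0, by omega⟩ : Fin n),
          ∑ q ∈ (Finset.univ.erase (⟨0, by omega⟩ : Fin n)).erase p,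
            (esigma (Finset.univ \ {(⟨0, by omega⟩ : Fin n), p, q}) ((n : ℤ) - 3) lam) ^ 2
              * ξ p * ξ q
    ≥ 0 := by
  obtain ⟨o, ho⟩ : ∃ o : Fin n, o = ⟨0, by omega⟩ := ⟨_, rfl⟩
  obtain ⟨B, hB⟩ : ∃ B : Finset (Fin n), B = Finset.univ.erase o := ⟨_, rfl⟩
  have hBcard : B.card = n - 1 := by simp [hB]
  have hset2 : ∀ j, Finset.univ \ {o, j} = B.erase j := fun j => by
    ext i
    simp only [hB, Finset.mem_sdiff, Finset.mem_erase, Finset.mem_insert, Finset.mem_singleton,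
      Finset.mem_univ]
    tauto
  have hset3 : ∀ p q, Finset.univ \ {o, p, q} = (B.erase p).erase q := fun p q => by
    ext i
    simp only [hB, Finset.mem_sdiff, Finset.mem_erase, Finset.mem_insert, Finset.mem_singleton,
      Finset.mem_univ]
    tauto
  have hcard1 : ∀ p ∈ B, (B.erase p).card = n - 2 := fun p hp => by
    rw [Finset.card_erase_of_mem hp]
    omega
  have hcard2 : ∀ p ∈ B, ∀ q ∈ B.erase p, ((B.erase p).erase q).card = n - 3 :=
    fun p hp q hq => by
      rw [Finset.card_erase_of_mem hq, hcard1 p hp]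
      omega
  have hrw : ∀ j ∈ B, Ssum α (B.erase j) ((n : ℤ) - 2) lam =
      ∑ i ∈ B.erase j, ∏ k ∈ (B.erase j).erase i, lam k + α * ∏ k ∈ B.erase j, lam k := by
    intro j hj
    have := hcard1 j hj
    rw [Ssum, esigma_card_sub_one _ _ (by omega) (by omega), esigma_card _ _ (by omega)]
  have hrw2 : ∀ p ∈ B, ∀ q ∈ B.erase p, esigma ((B.erase p).erase q) ((n : ℤ) - 3) lam =
      ∏ k ∈ (B.erase p).erase q, lam k := by
    intro p hp q hq
    have := hcard2 p hp q hq
    rw [esigma_card _ _ (by omega)]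
  rw [ge_iff_le, ← ho, ← hB]
  simp only [hset2, hset3]
  have hgoal : ∑ j ∈ B, (Ssum α (B.erase j) ((n : ℤ) - 2) lam) ^ 2 * ξ j ^ 2
      + ∑ p ∈ B, ∑ q ∈ B.erase p,
        (esigma ((B.erase p).erase q) ((n : ℤ) - 3) lam) ^ 2 * ξ p * ξ q =
      ∑ j ∈ B, (∑ i ∈ B.erase j, ∏ k ∈ (B.erase j).erase i, lam k
        + α * ∏ k ∈ B.erase j, lam k) ^ 2 * ξ j ^ 2
      + ∑ p ∈ B, ∑ q ∈ B.erase p, (∏ k ∈ (B.erase p).erase q, lam k) ^ 2 * ξ p * ξ q := by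
    congr 1
    · exact Finset.sum_congr rfl fun j hj => by rw [hrw j hj]
    · exact Finset.sum_congr rfl fun p hp => Finset.sum_congr rfl fun q hq => by
        rw [hrw2 p hp q hq]
  rw [hgoal]
  by_cases hpos : ∀ j ∈ B, 0 ≤ lam j
  · refine quadratic_form_nonneg_of_weights_nonneg B
      (fun p q => ∏ k ∈ (B.erase p).erase q, lam k) (fun p => α * ∏ k ∈ B.erase p, lam k) ξ
      (fun p q => by simp only [Finset.erase_right_comm]) (fun p _ q _ => ?_) (fun p _ => ?_)
    · exact Finset.prod_nonneg fun i hi =>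
        hpos i (Finset.mem_of_mem_erase (Finset.mem_of_mem_erase hi))
    · exact mul_nonneg hα (Finset.prod_nonneg fun i hi => hpos i (Finset.mem_of_mem_erase hi))
  push Not at hpos
  obtain ⟨m, hm, hneg⟩ := hpos
  obtain ⟨hΓ, hS⟩ := hlam
  have hesymm : ∀ j < (Finset.univ : Finset (Fin n)).card,
      0 < ∑ t ∈ (Finset.univ : Finset (Fin n)).powersetCard j, ∏ i ∈ t, lam i := by
    intro j hj
    rw [Finset.card_univ, Fintype.card_fin] at hj
    rcases Nat.eq_zero_or_pos j with rfl | hj0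
    · simp
    · simpa [esigma] using hΓ j hj0 (by omega)
  have hothers : ∀ i, i ≠ m → 0 < lam i := fun i hi => by
    by_contra! hle
    exact hi (eq_of_nonpos_of_esymm_pos Finset.univ lam hesymm (Finset.mem_univ i)
      (Finset.mem_univ m) hle hneg.le)
  have hom : o ≠ m := fun h => by
    rw [hB, h] at hm
    simp at hm
  have hnz : ∀ i, lam i ≠ 0 := fun i => by
    by_cases h : i = m
    · exact h ▸ hneg.ne
    · exact (hothers i h).ne'
  have herase : ∀ (A : Finset (Fin n)), ∀ i ∈ A,
      ∏ k ∈ A.erase i, lam k = (∏ k ∈ A, lam k) * (lam i)⁻¹ := fun A i hi => by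
    rw [← Finset.mul_prod_erase A lam hi]
    field_simp [hnz i]
  have hT : ∑ i ∈ B, (lam i)⁻¹ + α < 0 := by
    have h1 : Ssum α Finset.univ (n : ℤ) lam =
        (∏ k, lam k) * (∑ i, (lam i)⁻¹ + α) := by
      rw [Ssum, esigma_card_sub_one _ _ (by simp) (by simp; omega), esigma_card _ _ (by simp),
        Finset.sum_congr rfl (herase Finset.univ), ← Finset.mul_sum]
      ring
    have h2 : ∏ k, lam k < 0 := by
      rw [← Finset.mul_prod_erase Finset.univ lam (Finset.mem_univ m)]
      exact mul_neg_of_neg_of_pos hneg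
        (Finset.prod_pos fun i hi => hothers i (Finset.ne_of_mem_erase hi))
    have h3 : 0 < (∏ k, lam k) * (∑ i, (lam i)⁻¹ + α) := h1 ▸ hS
    have h4 := neg_of_mul_pos_right h3 h2.le
    have h5 := Finset.add_sum_erase Finset.univ (fun i => (lam i)⁻¹) (Finset.mem_univ o)
    have h6 : 0 < (lam o)⁻¹ := inv_pos.2 (hothers o hom)
    rw [← hB] at h5
    linarith
  have hcore := quadratic_form_nonneg_of_one_neg B (fun i => (lam i)⁻¹) ξ α hα hm
    (fun j hj => inv_pos.2 (hothers j (Finset.ne_of_mem_erase hj)))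
    (Finset.card_pos.1 (by rw [hcard1 m hm]; omega)) hT
  have hP : 0 ≤ (∏ k ∈ B, lam k) ^ 2 := sq_nonneg _
  refine (mul_nonneg hP hcore).trans_eq ?_
  rw [mul_add, Finset.mul_sum, Finset.mul_sum]
  congr 1
  · refine Finset.sum_congr rfl fun j hj => ?_
    rw [Finset.sum_congr rfl (herase (B.erase j)), ← Finset.mul_sum, herase B j hj]
    ring
  · refine Finset.sum_congr rfl fun p hp => ?_
    rw [Finset.mul_sum]
    refine Finset.sum_congr rfl fun q hq => ?_
    rw [herase _ q hq, herase B p hp]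
    ring
end
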